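/- arXiv:1512.01485 — 2 statements merged into one kernel-verified Lean document; each statement's English description precedes it below -/
import Mathlib

section
/- A pointed pseudo-triangulation of a set of n points in general position in the plane has exactly 2n - 3 edges. -/
open scoped RealInnerProductSpace Classical

/-- Points in the Euclidean plane. -/
abbrev Pt := EuclideanSpace ℝ (Fin 2)

/-- The closed segment spanned by an unordered pair of points. -/
noncomputable def seg (e : Sym2 Pt) : Set Pt :=
  Sym2.lift ⟨fun p q => segment ℝ p q, fun p q => segment_symm ℝ p q⟩ e

/-- The open segment spanned by an unordered pair of points. -/
noncomputable def oseg (e : Sym2 Pt) : Set Pt :=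
  Sym2.lift ⟨fun p q => openSegment ℝ p q, fun p q => openSegment_symm ℝ p q⟩ e

/-- A plane straight-line graph on a finite point set `P`. -/
structure PlaneGraph (P : Finset Pt) where
  edges : Finset (Sym2 Pt)
  not_isDiag : ∀ e ∈ edges, ¬ e.IsDiag
  endpoints_mem : ∀ e ∈ edges, ∀ p ∈ e, p ∈ P
  noncrossing : ∀ e ∈ edges, ∀ f ∈ edges, e ≠ f → oseg e ∩ oseg f = ∅
  no_vertex_interior : ∀ e ∈ edges, ∀ p ∈ P, p ∉ oseg e

/-- `v` is pointed: all edges at `v` lie strictly inside an open half-plane. -/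
def PointedAt {P : Finset Pt} (G : PlaneGraph P) (v : Pt) : Prop :=
  ∃ u : Pt, ∀ e ∈ G.edges, v ∈ e → ∀ w ∈ e, w ≠ v → 0 < ⟪u, w - v⟫

def PointedGraph {P : Finset Pt} (G : PlaneGraph P) : Prop := ∀ v ∈ P, PointedAt G v

/-- Pointed pseudo-triangulation = maximal pointed plane straight-line graph (Streinu). -/
def IsPointedPseudoTriangulation {P : Finset Pt} (G : PlaneGraph P) : Prop :=
  PointedGraph G ∧ ∀ G' : PlaneGraph P, PointedGraph G' → G.edges ⊆ G'.edges → G'.edges = G.edges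

def GeneralPosition (P : Finset Pt) : Prop :=
  ∀ p ∈ P, ∀ q ∈ P, ∀ r ∈ P, p ≠ q → p ≠ r → q ≠ r → ¬ Collinear ℝ ({p, q, r} : Set Pt)

/-- The vertices of `P` on its convex hull boundary. -/
noncomputable def hullVertices (P : Finset Pt) : Finset Pt :=
  P.filter fun p => p ∈ frontier (convexHull ℝ (P : Set Pt))

/-- The internal (non-convex-hull) edges of a plane graph. -/
noncomputable def internalEdges {P : Finset Pt} (G : PlaneGraph P) : Finset (Sym2 Pt) :=
  G.edges.filter fun e => ¬ (seg e ⊆ frontier (convexHull ℝ (P : Set Pt)))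

/-- The cross product of two plane vectors. -/
noncomputable def cross (a b : ℂ) : ℝ := (starRingEnd ℂ a * b).im

theorem cross_def (a b : ℂ) : cross a b = a.re * b.im - a.im * b.re := by
  simp [cross]; ring

theorem inner_eq_re_mul_add (a b : ℂ) : inner ℝ a b = a.re * b.re + a.im * b.im := by
  simp [Complex.inner]; ring

/-- The contribution of a segment whose endpoints lie at `a` and `b` relative to the viewpoint
to the Airy function, averaged over the directions of the cutting ray. -/
noncomputable def airyKernel (a b : ℂ) : ℝ :=
  cross a b * Complex.arg (starRingEnd ℂ a * b)

/-- The contribution of a segment to the Airy function computed with the cutting ray in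
direction `d`. -/
noncomputable def cutKernel (d a b : ℂ) : ℝ :=
  cross a b * (Complex.arg (starRingEnd ℂ a * b)
    - (Complex.arg (-(b * starRingEnd ℂ d)) - Complex.arg (-(a * starRingEnd ℂ d))))

theorem continuous_im_mul_arg : Continuous fun w : ℂ => w.im * Complex.arg w := by
  rw [continuous_iff_continuousAt]
  intro w
  by_cases hw : w ∈ Complex.slitPlane
  · exact Complex.continuous_im.continuousAt.mul (Complex.continuousAt_arg hw)
  · have him : w.im = 0 := by
      by_contra h
      exact hw (Complex.mem_slitPlane_iff.2 (Or.inr h))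
    have h0 : Filter.Tendsto (fun w : ℂ => |w.im| * Real.pi) (nhds w) (nhds 0) := by
      have : Continuous fun w : ℂ => |w.im| * Real.pi := by fun_prop
      simpa [him] using this.tendsto w
    unfold ContinuousAt
    simp only [him, zero_mul]
    refine squeeze_zero_norm (fun v => ?_) h0
    rw [Real.norm_eq_abs, abs_mul]
    exact mul_le_mul_of_nonneg_left (Complex.abs_arg_le_pi v) (abs_nonneg _)

theorem continuous_airyKernel (p q : ℂ) : Continuous fun x => airyKernel (p - x) (q - x) :=
  continuous_im_mul_arg.comp
    (f := fun x => starRingEnd ℂ (p - x) * (q - x)) (by fun_prop)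

/-- With respect to two vectors avoiding the negative real axis, the principal argument of
`conj A * B` is the difference of arguments unless the segment from `A` to `B` crosses that
axis. -/
theorem arg_conj_mul_cases {A B : ℂ} (hA : A ∈ Complex.slitPlane) (hB : B ∈ Complex.slitPlane) :
    Complex.arg (starRingEnd ℂ A * B) = Complex.arg B - Complex.arg A ∨
    (A.im < 0 ∧ 0 ≤ B.im ∧ cross A B ≤ 0 ∧
      Complex.arg (starRingEnd ℂ A * B) = Complex.arg B - Complex.arg A - 2 * Real.pi) ∨
    (0 ≤ A.im ∧ B.im < 0 ∧ 0 ≤ cross A B ∧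
      Complex.arg (starRingEnd ℂ A * B) = Complex.arg B - Complex.arg A + 2 * Real.pi) := by
  have hA0 := Complex.slitPlane_ne_zero hA
  have hB0 := Complex.slitPlane_ne_zero hB
  have hA0' : starRingEnd ℂ A ≠ 0 := by simpa using hA0
  have hangle : ((Complex.arg (starRingEnd ℂ A * B) : ℝ) : Real.Angle)
      = ((Complex.arg B - Complex.arg A : ℝ) : Real.Angle) := by
    rw [Complex.arg_mul_coe_angle hA0' hB0, Complex.arg_conj_coe_angle]
    rw [Real.Angle.coe_sub]
    abel
  obtain ⟨k, hk⟩ := Real.Angle.angle_eq_iff_two_pi_dvd_sub.1 hangle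
  have h1 := Complex.neg_pi_lt_arg A
  have h2 := lt_of_le_of_ne (Complex.arg_le_pi A) (Complex.mem_slitPlane_iff_arg.1 hA).1
  have h3 := Complex.neg_pi_lt_arg B
  have h4 := lt_of_le_of_ne (Complex.arg_le_pi B) (Complex.mem_slitPlane_iff_arg.1 hB).1
  have h5 := Complex.neg_pi_lt_arg (starRingEnd ℂ A * B)
  have h6 := Complex.arg_le_pi (starRingEnd ℂ A * B)
  have hpi := Real.pi_pos
  have hk1 : k < 2 := by
    by_contra! h
    have : (2 : ℝ) ≤ k := by exact_mod_cast h
    nlinarith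
  have hk2 : -2 < k := by
    by_contra! h
    have : (k : ℝ) ≤ -2 := by exact_mod_cast h
    nlinarith
  have hk3 : k = -1 ∨ k = 0 ∨ k = 1 := by omega
  rcases hk3 with rfl | rfl | rfl
  · right; left
    push_cast at hk
    refine ⟨Complex.arg_neg_iff.1 (by linarith), Complex.arg_nonneg_iff.1 (by linarith), ?_,
      by linarith⟩
    have : Complex.arg (starRingEnd ℂ A * B) ≤ 0 := by linarith
    by_contra! h
    rcases this.lt_or_eq with h' | h'
    · have := Complex.arg_neg_iff.1 h'
      unfold cross at h
      linarith
    · have := (Complex.arg_eq_zero_iff.1 h').2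
      unfold cross at h
      linarith
  · left
    push_cast at hk
    linarith
  · right; right
    push_cast at hk
    exact ⟨Complex.arg_nonneg_iff.1 (by linarith), Complex.arg_neg_iff.1 (by linarith),
      Complex.arg_nonneg_iff.1 (by linarith), by linarith⟩

theorem cross_neg_mul_conj (d a b : ℂ) :
    cross (-(a * starRingEnd ℂ d)) (-(b * starRingEnd ℂ d)) = Complex.normSq d * cross a b := by
  simp [cross_def, Complex.normSq_apply]; ring

theorem arg_conj_mul_rotate {d : ℂ} (hd : d ≠ 0) (a b : ℂ) :
    Complex.arg (starRingEnd ℂ (-(a * starRingEnd ℂ d)) * -(b * starRingEnd ℂ d))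
      = Complex.arg (starRingEnd ℂ a * b) := by
  have : starRingEnd ℂ (-(a * starRingEnd ℂ d)) * -(b * starRingEnd ℂ d)
      = (Complex.normSq d : ℂ) * (starRingEnd ℂ a * b) := by
    rw [Complex.normSq_eq_conj_mul_self]
    simp
    ring
  rw [this, Complex.arg_real_mul _ (Complex.normSq_pos.2 hd)]

theorem cutKernel_nonneg {d a b : ℂ} (hd : d ≠ 0)
    (ha : -(a * starRingEnd ℂ d) ∈ Complex.slitPlane)
    (hb : -(b * starRingEnd ℂ d) ∈ Complex.slitPlane) : 0 ≤ cutKernel d a b := by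
  have hn := Complex.normSq_pos.2 hd
  have hc := cross_neg_mul_conj d a b
  have h := arg_conj_mul_cases ha hb
  rw [arg_conj_mul_rotate hd, hc] at h
  unfold cutKernel
  have hpi := Real.pi_pos
  rcases h with h | ⟨-, -, h1, h⟩ | ⟨-, -, h1, h⟩
  · rw [h]; simp
  · have : cross a b ≤ 0 := by
      by_contra! h'
      nlinarith [mul_pos hn h']
    rw [h]
    nlinarith
  · have : 0 ≤ cross a b := nonneg_of_mul_nonneg_right h1 hn
    rw [h]
    nlinarith

/-- If the cut kernel does not vanish, the cutting ray meets the segment. -/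
theorem exists_pos_combination_of_cutKernel_ne_zero {d a b : ℂ} (hd : d ≠ 0)
    (ha : -(a * starRingEnd ℂ d) ∈ Complex.slitPlane)
    (hb : -(b * starRingEnd ℂ d) ∈ Complex.slitPlane) (h : cutKernel d a b ≠ 0) :
    ∃ α β γ : ℝ, 0 ≤ α ∧ 0 ≤ β ∧ 0 < γ ∧ α • a + β • b = γ • d := by
  have hn := Complex.normSq_pos.2 hd
  have hc := cross_neg_mul_conj d a b
  have h' := arg_conj_mul_cases ha hb
  rw [arg_conj_mul_rotate hd, hc] at h'
  have h0 : cross a b ≠ 0 := fun h0 => h (by simp [cutKernel, h0])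
  have e1 : (-(a * starRingEnd ℂ d)).im = cross a d := by simp [cross_def]; ring
  have e2 : (-(b * starRingEnd ℂ d)).im = cross b d := by simp [cross_def]; ring
  rw [e1, e2] at h'
  have key : (cross b d) • a + (- cross a d) • b = (- cross a b) • d := by
    apply Complex.ext <;> simp [cross_def] <;> ring
  rcases h' with h' | ⟨h1, h2, h3, h'⟩ | ⟨h1, h2, h3, h'⟩
  · exact absurd (by rw [cutKernel, h']; simp) h
  · refine ⟨cross b d, - cross a d, - cross a b, h2, by linarith, ?_, key⟩
    have : cross a b ≤ 0 := by
      by_contra! h'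
      nlinarith [mul_pos hn h']
    have := lt_of_le_of_ne this h0
    linarith
  · refine ⟨- cross b d, cross a d, cross a b, by linarith, h1,
      lt_of_le_of_ne (nonneg_of_mul_nonneg_right h3 hn) (Ne.symm h0), ?_⟩
    have := congrArg Neg.neg key
    simp only [neg_smul, neg_add_rev, neg_neg] at this ⊢
    rw [← this]; abel

theorem cutKernel_ne_zero_of_pos_combination {d a b : ℂ} (hd : d ≠ 0) {α β γ : ℝ}
    (hα : 0 < α) (hβ : 0 < β) (hγ : 0 < γ) (h : α • a + β • b = γ • d) (h0 : cross a d ≠ 0) :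
    cutKernel d a b ≠ 0 := by
  have hn := Complex.normSq_pos.2 hd
  have e1 : (-(a * starRingEnd ℂ d)).im = cross a d := by simp [cross_def]; ring
  have e2 : (-(b * starRingEnd ℂ d)).im = cross b d := by simp [cross_def]; ring
  have hre := congrArg Complex.re h
  have him := congrArg Complex.im h
  simp at hre him
  have k1 : α * cross a d + β * cross b d = 0 := by
    simp only [cross_def]
    linear_combination d.im * hre - d.re * him
  have k2 : β * cross a b = γ * cross a d := by
    simp only [cross_def]
    linear_combination a.re * him - a.im * hre
  have hab : cross a b ≠ 0 := by
    intro h'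
    rw [h', mul_zero] at k2
    exact (mul_ne_zero hγ.ne' h0) k2.symm
  have hb0 : cross b d ≠ 0 := by
    intro h'
    rw [h', mul_zero, add_zero] at k1
    exact (mul_ne_zero hα.ne' h0) k1
  have hsa : -(a * starRingEnd ℂ d) ∈ Complex.slitPlane :=
    Complex.mem_slitPlane_iff.2 (Or.inr (by rwa [e1]))
  have hsb : -(b * starRingEnd ℂ d) ∈ Complex.slitPlane :=
    Complex.mem_slitPlane_iff.2 (Or.inr (by rwa [e2]))
  have hpi := Real.pi_pos
  have hlo := Complex.neg_pi_lt_arg (starRingEnd ℂ a * b)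
  have hhi := Complex.arg_le_pi (starRingEnd ℂ a * b)
  have hp := Complex.neg_pi_lt_arg (-(a * starRingEnd ℂ d))
  intro hcut
  have hcut' : Complex.arg (starRingEnd ℂ a * b) =
      Complex.arg (-(b * starRingEnd ℂ d)) - Complex.arg (-(a * starRingEnd ℂ d)) := by
    rcases mul_eq_zero.1 hcut with h' | h'
    · exact absurd h' hab
    · linarith
  rcases lt_or_gt_of_ne h0 with hlt | hgt
  · have hb1 : 0 < cross b d := by
      by_contra! h'
      nlinarith [mul_neg_of_pos_of_neg hα hlt, mul_nonneg hβ.le (neg_nonneg.2 h')]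
    have hc1 : cross a b < 0 := by
      by_contra! h'
      nlinarith [mul_neg_of_pos_of_neg hγ hlt, mul_nonneg hβ.le h']
    have t1 := Complex.arg_neg_iff.2 (e1 ▸ hlt)
    have t2 := Complex.arg_nonneg_iff.2 (e2 ▸ hb1.le)
    have t3 : Complex.arg (starRingEnd ℂ a * b) < 0 := Complex.arg_neg_iff.2 hc1
    linarith
  · have hb1 : cross b d < 0 := by
      by_contra! h'
      nlinarith [mul_pos hα hgt, mul_nonneg hβ.le h']
    have hc1 : 0 < cross a b := by
      by_contra! h'
      nlinarith [mul_pos hγ hgt, mul_nonneg hβ.le (neg_nonneg.2 h')]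
    have t1 := Complex.arg_nonneg_iff.2 (e1 ▸ hgt.le)
    have t2 := Complex.arg_neg_iff.2 (e2 ▸ hb1)
    have t3 : 0 ≤ Complex.arg (starRingEnd ℂ a * b) := Complex.arg_nonneg_iff.2 hc1.le
    linarith

theorem conj_mul_mem_slitPlane_of_notMem_segment {p q x : ℂ} (hx : x ∉ segment ℝ p q) :
    starRingEnd ℂ (p - x) * (q - x) ∈ Complex.slitPlane := by
  by_contra h
  apply hx
  rw [Complex.mem_slitPlane_iff] at h
  push Not at h
  obtain ⟨hre, him⟩ := h
  set a := p - x with ha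
  set b := q - x with hb
  by_cases ha0 : a = 0
  · have : x = p := (sub_eq_zero.1 ha0).symm
    rw [this]; exact left_mem_segment ℝ p q
  have hn := Complex.normSq_pos.2 ha0
  set m := -(starRingEnd ℂ a * b).re with hm
  have hm0 : 0 ≤ m := by linarith
  have hs : 0 < m + Complex.normSq a := by linarith
  refine ⟨m / (m + Complex.normSq a), Complex.normSq a / (m + Complex.normSq a),
    div_nonneg hm0 hs.le, div_nonneg hn.le hs.le, by field_simp, ?_⟩
  have key : m • a + Complex.normSq a • b = 0 := by
    simp at him
    rw [hm]
    apply Complex.ext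
    · simp [Complex.normSq_apply]
      linear_combination (-a.im) * him
    · simp [Complex.normSq_apply]
      linear_combination a.re * him
  have hp : p = x + a := by rw [ha]; ring
  have hq : q = x + b := by rw [hb]; ring
  have hsum : m / (m + Complex.normSq a) + Complex.normSq a / (m + Complex.normSq a) = 1 := by
    field_simp
  rw [hp, hq, smul_add, smul_add, add_add_add_comm, ← add_smul, hsum, one_smul, div_eq_inv_mul,
    div_eq_inv_mul, mul_smul, mul_smul, ← smul_add, key, smul_zero, add_zero]

theorem eventually_cutKernel_eq {d p q x : ℂ} (hd : d ≠ 0)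
    (hp : -((p - x) * starRingEnd ℂ d) ∈ Complex.slitPlane)
    (hq : -((q - x) * starRingEnd ℂ d) ∈ Complex.slitPlane)
    (hx : x ∉ segment ℝ p q) :
    ∃ c : ℝ, ∀ᶠ y in nhds x, cutKernel d (p - y) (q - y) = cross (p - y) (q - y) * c := by
  have hpx : p - x ≠ 0 := fun h => Complex.slitPlane_ne_zero hp (by simp [h])
  have hqx : q - x ≠ 0 := fun h => Complex.slitPlane_ne_zero hq (by simp [h])
  let h : ℂ → ℝ := fun y => Complex.arg (starRingEnd ℂ (p - y) * (q - y))
    - (Complex.arg (-((q - y) * starRingEnd ℂ d)) - Complex.arg (-((p - y) * starRingEnd ℂ d)))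
  have hcont : ContinuousAt h x := by
    refine ContinuousAt.sub ?_ (ContinuousAt.sub ?_ ?_)
    · exact ContinuousAt.comp (g := Complex.arg) (f := fun y => starRingEnd ℂ (p - y) * (q - y))
        (Complex.continuousAt_arg (conj_mul_mem_slitPlane_of_notMem_segment hx)) (by fun_prop)
    · exact ContinuousAt.comp (g := Complex.arg) (f := fun y => -((q - y) * starRingEnd ℂ d))
        (Complex.continuousAt_arg hq) (by fun_prop)
    · exact ContinuousAt.comp (g := Complex.arg) (f := fun y => -((p - y) * starRingEnd ℂ d))
        (Complex.continuousAt_arg hp) (by fun_prop)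
  have hval : ∀ y, p - y ≠ 0 → q - y ≠ 0 → ((h y : ℝ) : Real.Angle) = 0 := by
    intro y h1 h2
    have hd' : starRingEnd ℂ d ≠ 0 := (map_ne_zero _).2 hd
    have h1' : starRingEnd ℂ (p - y) ≠ 0 := (map_ne_zero _).2 h1
    simp only [h, Real.Angle.coe_sub]
    rw [← mul_neg, ← mul_neg, Complex.arg_mul_coe_angle h1' h2,
      Complex.arg_mul_coe_angle h2 (neg_ne_zero.2 hd'),
      Complex.arg_mul_coe_angle h1 (neg_ne_zero.2 hd'), Complex.arg_conj_coe_angle]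
    abel
  refine ⟨h x, ?_⟩
  have e1 : ∀ᶠ y in nhds x, p - y ≠ 0 :=
    (by fun_prop : ContinuousAt (fun y => p - y) x).eventually_ne hpx
  have e2 : ∀ᶠ y in nhds x, q - y ≠ 0 :=
    (by fun_prop : ContinuousAt (fun y => q - y) x).eventually_ne hqx
  have e3 : ∀ᶠ y in nhds x, |h y - h x| < 2 * Real.pi := by
    have := Metric.continuousAt_iff'.1 hcont (2 * Real.pi) (by positivity)
    simpa [Real.dist_eq] using this
  filter_upwards [e1, e2, e3] with y h1 h2 h3
  have hk := (hval y h1 h2).trans (hval x hpx hqx).symm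
  obtain ⟨k, hk⟩ := Real.Angle.angle_eq_iff_two_pi_dvd_sub.1 hk
  have hk0 : k = 0 := by
    by_contra hne
    have : (1 : ℝ) ≤ |(k : ℝ)| := by exact_mod_cast Int.one_le_abs hne
    rw [hk, abs_mul, abs_of_pos (by positivity : (0 : ℝ) < 2 * Real.pi)] at h3
    nlinarith [Real.pi_pos]
  have : h y = h x := by
    rw [hk0] at hk
    simp at hk
    linarith
  rw [← this, cutKernel]

theorem tendsto_add_smul_nhds_zero (x τ : ℂ) :
    Filter.Tendsto (fun r : ℝ => x + r • τ) (nhds 0) (nhds x) := by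
  have : Continuous fun r : ℝ => x + r • τ := by fun_prop
  simpa using this.tendsto 0

theorem tendsto_sub_smul_nhds_zero (x τ : ℂ) :
    Filter.Tendsto (fun r : ℝ => x - r • τ) (nhds 0) (nhds x) := by
  have : Continuous fun r : ℝ => x - r • τ := by fun_prop
  simpa using this.tendsto 0

/-- Off the segment, the cut kernel is locally affine along lines. -/
theorem eventually_cutKernel_add_eq {d p q x : ℂ} (hd : d ≠ 0)
    (hp : -((p - x) * starRingEnd ℂ d) ∈ Complex.slitPlane)
    (hq : -((q - x) * starRingEnd ℂ d) ∈ Complex.slitPlane)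
    (hx : x ∉ segment ℝ p q) (τ : ℂ) :
    ∀ᶠ r : ℝ in nhds 0,
      cutKernel d (p - (x + r • τ)) (q - (x + r • τ))
        + cutKernel d (p - (x - r • τ)) (q - (x - r • τ)) = 2 * cutKernel d (p - x) (q - x) := by
  obtain ⟨c, hc⟩ := eventually_cutKernel_eq hd hp hq hx
  filter_upwards [(tendsto_add_smul_nhds_zero x τ).eventually hc,
    (tendsto_sub_smul_nhds_zero x τ).eventually hc] with r h1 h2
  rw [h1, h2, hc.self_of_nhds]
  simp [cross_def]
  ring

section Airy

variable {ι E : Type*} [Fintype E] (z : ι → ℂ) (s t : E → ι)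

/-- Equilibrium stresses of the framework with vertices `z` and bars `e` from `s e` to `t e`:
weights annihilated by every infinitesimal motion. -/
def IsStress (ω : E → ℝ) : Prop :=
  ∀ v : ι → ℂ, ∑ e, ω e * inner ℝ (z (s e) - z (t e)) (v (s e) - v (t e)) = 0

/-- The Airy stress function (Maxwell–Cremona lifting). -/
noncomputable def airy (ω : E → ℝ) (x : ℂ) : ℝ :=
  ∑ e, ω e * airyKernel (z (s e) - x) (z (t e) - x)

variable {z s t}

theorem airy_eq_sum_cutKernel {ω : E → ℝ} (hω : IsStress z s t ω) (d x : ℂ) :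
    airy z s t ω x = ∑ e, ω e * cutKernel d (z (s e) - x) (z (t e) - x) := by
  let θ : ι → ℝ := fun i => Complex.arg (-((z i - x) * starRingEnd ℂ d))
  have h := hω fun i => θ i • (Complex.I * (z i - x))
  rw [airy, ← sub_eq_zero, ← Finset.sum_sub_distrib, ← h]
  refine Finset.sum_congr rfl fun e _ => ?_
  have : inner ℝ (z (s e) - z (t e))
      (θ (s e) • (Complex.I * (z (s e) - x)) - θ (t e) • (Complex.I * (z (t e) - x)))
      = (θ (t e) - θ (s e)) * cross (z (s e) - x) (z (t e) - x) := by
    rw [inner_eq_re_mul_add, cross_def]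
    simp
    ring
  rw [this, airyKernel, cutKernel]
  ring

theorem continuous_airy (ω : E → ℝ) : Continuous (airy z s t ω) :=
  continuous_finsetSum _ fun _ _ => continuous_const.mul (continuous_airyKernel _ _)

theorem airy_eq_zero_of_norm_lt [Finite ι] {ω : E → ℝ} (hω : IsStress z s t ω) :
    ∃ R : ℝ, ∀ x, R < ‖x‖ → airy z s t ω x = 0 := by
  obtain ⟨R, hR⟩ := (Set.finite_range fun i => ‖z i‖).bddAbove
  refine ⟨max R 0, fun x hx => ?_⟩
  have hx0 : x ≠ 0 := norm_pos_iff.1 ((le_max_right _ _).trans_lt hx)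
  have hin : ∀ i, inner ℝ (z i - x) x < 0 := by
    intro i
    have h1 : ‖z i‖ ≤ R := hR ⟨i, rfl⟩
    have h2 := real_inner_le_norm (z i) x
    rw [inner_sub_left, real_inner_self_eq_norm_sq]
    have h3 : ‖z i‖ < ‖x‖ := h1.trans_lt ((le_max_left _ _).trans_lt hx)
    have := norm_pos_iff.2 hx0
    nlinarith
  have hslit : ∀ i, -((z i - x) * starRingEnd ℂ x) ∈ Complex.slitPlane := by
    intro i
    refine Complex.mem_slitPlane_iff.2 (Or.inl ?_)
    have := hin i
    rw [inner_eq_re_mul_add] at this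
    simp at this ⊢
    linarith
  rw [airy_eq_sum_cutKernel hω x]
  refine Finset.sum_eq_zero fun e _ => ?_
  rw [mul_eq_zero]; right
  by_contra hne
  obtain ⟨α, β, γ, hα, hβ, hγ, h⟩ :=
    exists_pos_combination_of_cutKernel_ne_zero hx0 (hslit _) (hslit _) hne
  have := congrArg (fun w => inner ℝ w x) h
  simp only [inner_add_left, real_inner_smul_left] at this
  have hxx : 0 < inner ℝ x x := real_inner_self_pos.2 hx0
  nlinarith [mul_nonneg hα (neg_nonneg.2 (hin (s e)).le),
    mul_nonneg hβ (neg_nonneg.2 (hin (t e)).le), mul_pos hγ hxx]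

theorem exists_generic_direction [Finite ι] (w : ι → ℂ) {u : ℂ} (hu : u ≠ 0) :
    ∃ d : ℂ, inner ℝ u d < 0 ∧ ∀ i, w i ≠ 0 → cross d (w i) ≠ 0 := by
  have hfin : (⋃ i, {r : ℝ | w i ≠ 0 ∧ cross (-u + r • (Complex.I * u)) (w i) = 0}).Finite := by
    refine Set.finite_iUnion fun i => Set.Subsingleton.finite ?_
    rintro r ⟨h0, h1⟩ r' ⟨-, h2⟩
    simp [cross_def] at h1 h2
    by_contra hne
    have hne' := sub_ne_zero.2 hne
    have k1 : u.re * (w i).re + u.im * (w i).im = 0 := by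
      apply mul_left_cancel₀ hne'
      linear_combination h2 - h1
    have k2 : u.re * (w i).im - u.im * (w i).re = 0 := by
      linear_combination -h1 - r * k1
    have hn := Complex.normSq_pos.2 hu
    rw [Complex.normSq_apply] at hn
    apply h0
    apply Complex.ext
    · apply mul_left_cancel₀ hn.ne'
      rw [Complex.zero_re, mul_zero]
      linear_combination u.re * k1 - u.im * k2
    · apply mul_left_cancel₀ hn.ne'
      rw [Complex.zero_im, mul_zero]
      linear_combination u.im * k1 + u.re * k2
  obtain ⟨r, hr⟩ := hfin.infinite_compl.nonempty
  refine ⟨-u + r • (Complex.I * u), ?_, fun i hi h => hr (Set.mem_iUnion.2 ⟨i, hi, h⟩)⟩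
  have hn := Complex.normSq_pos.2 hu
  rw [Complex.normSq_apply] at hn
  rw [inner_eq_re_mul_add]
  simp
  nlinarith

end Airy

section Maximum

variable {ι E : Type*} [Finite ι] [Fintype E] {z : ι → ℂ} {s t : E → ι}

theorem im_neg_mul_conj (a d : ℂ) : (-(a * starRingEnd ℂ d)).im = -cross d a := by
  simp [cross_def]; ring

theorem eventually_mem_slitPlane {p x d τ : ℂ} (hτ : cross d τ ≠ 0)
    (hp : p - x ≠ 0 → cross d (p - x) ≠ 0) :
    ∀ᶠ r : ℝ in nhdsWithin 0 {0}ᶜ,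
      -((p - (x + r • τ)) * starRingEnd ℂ d) ∈ Complex.slitPlane ∧
      -((p - (x - r • τ)) * starRingEnd ℂ d) ∈ Complex.slitPlane := by
  simp only [Complex.mem_slitPlane_iff, im_neg_mul_conj]
  suffices h : ∀ᶠ r : ℝ in nhdsWithin 0 {0}ᶜ,
      cross d (p - (x + r • τ)) ≠ 0 ∧ cross d (p - (x - r • τ)) ≠ 0 by
    filter_upwards [h] with r hr
    exact ⟨Or.inr (neg_ne_zero.2 hr.1), Or.inr (neg_ne_zero.2 hr.2)⟩
  by_cases h0 : p - x = 0
  · filter_upwards [self_mem_nhdsWithin] with r hr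
    have hr : r ≠ 0 := hr
    have e1 : cross d (p - (x + r • τ)) = -(r * cross d τ) := by
      rw [← sub_sub, h0]; simp [cross_def]; ring
    have e2 : cross d (p - (x - r • τ)) = r * cross d τ := by
      rw [← sub_add, h0]; simp [cross_def]; ring
    rw [e1, e2]
    exact ⟨neg_ne_zero.2 (mul_ne_zero hr hτ), mul_ne_zero hr hτ⟩
  · refine Filter.Eventually.filter_mono nhdsWithin_le_nhds ?_
    have hc : ContinuousAt (fun y => cross d (p - y)) x := by
      unfold cross
      exact Complex.continuous_im.continuousAt.comp (by fun_prop)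
    have := hc.eventually_ne (hp h0)
    exact ((tendsto_add_smul_nhds_zero x τ).eventually this).and
      ((tendsto_sub_smul_nhds_zero x τ).eventually this)

theorem cross_eq_zero_of_mem_segment {p q x : ℂ} (hx : x ∈ segment ℝ p q) :
    cross (p - x) (q - x) = 0 := by
  obtain ⟨α, β, -, -, h, rfl⟩ := hx
  have : α = 1 - β := by linarith
  subst this
  simp [cross_def]
  ring

/-- The Airy function is convex across every line through `x` which weakly separates the
negative bars through `x`. -/
theorem eventually_two_mul_airy_le {ω : E → ℝ} (hω : IsStress z s t ω) {F : Set E}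
    (hpos : ∀ e, e ∉ F → 0 ≤ ω e) {x u : ℂ} (hu : u ≠ 0)
    (hF : ∀ e ∈ F, x ∈ segment ℝ (z (s e)) (z (t e)) →
      0 ≤ inner ℝ u (z (s e) - x) ∧ 0 ≤ inner ℝ u (z (t e) - x)) :
    ∀ᶠ r : ℝ in nhdsWithin 0 {0}ᶜ, 2 * airy z s t ω x ≤
      airy z s t ω (x + r • (Complex.I * u)) + airy z s t ω (x - r • (Complex.I * u)) := by
  obtain ⟨d, hud, hd⟩ := exists_generic_direction (fun i => z i - x) hu
  have hd0 : d ≠ 0 := by rintro rfl; simp at hud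
  set τ := Complex.I * u with hτ
  have hdτ : cross d τ ≠ 0 := by
    have : cross d τ = inner ℝ u d := by
      rw [inner_eq_re_mul_add, cross_def, hτ]; simp; ring
    rw [this]; exact hud.ne
  have huτ : inner ℝ u τ = 0 := by rw [inner_eq_re_mul_add, hτ]; simp; ring
  have hslit : ∀ i, z i - x ≠ 0 → -((z i - x) * starRingEnd ℂ d) ∈ Complex.slitPlane := by
    intro i hi
    rw [Complex.mem_slitPlane_iff, im_neg_mul_conj]
    exact Or.inr (neg_ne_zero.2 (hd i hi))
  have hev : ∀ᶠ r : ℝ in nhdsWithin 0 {0}ᶜ, ∀ e, 2 * (ω e * cutKernel d (z (s e) - x) (z (t e) - x))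
      ≤ ω e * cutKernel d (z (s e) - (x + r • τ)) (z (t e) - (x + r • τ))
        + ω e * cutKernel d (z (s e) - (x - r • τ)) (z (t e) - (x - r • τ)) := by
    rw [Filter.eventually_all]
    intro e
    by_cases hx : x ∈ segment ℝ (z (s e)) (z (t e))
    · have h0 : cutKernel d (z (s e) - x) (z (t e) - x) = 0 := by
        rw [cutKernel, cross_eq_zero_of_mem_segment hx, zero_mul]
      filter_upwards [eventually_mem_slitPlane hdτ (hd (s e)),
        eventually_mem_slitPlane hdτ (hd (t e))] with r h1 h2
      rw [h0]
      by_cases he : e ∈ F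
      · have hvan : ∀ y, inner ℝ u (y - x) = 0 →
            -((z (s e) - y) * starRingEnd ℂ d) ∈ Complex.slitPlane →
            -((z (t e) - y) * starRingEnd ℂ d) ∈ Complex.slitPlane →
            cutKernel d (z (s e) - y) (z (t e) - y) = 0 := by
          intro y hy g1 g2
          by_contra hne
          obtain ⟨α, β, γ, hα, hβ, hγ, h⟩ :=
            exists_pos_combination_of_cutKernel_ne_zero hd0 g1 g2 hne
          have h' := congrArg (fun w => inner ℝ u w) h
          have e1 : inner ℝ u (z (s e) - y) = inner ℝ u (z (s e) - x) := by
            rw [← sub_sub_sub_cancel_right _ _ x, inner_sub_right, hy, sub_zero]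
          have e2 : inner ℝ u (z (t e) - y) = inner ℝ u (z (t e) - x) := by
            rw [← sub_sub_sub_cancel_right _ _ x, inner_sub_right, hy, sub_zero]
          simp only [inner_add_right, real_inner_smul_right, e1, e2] at h'
          have := hF e he hx
          nlinarith [mul_nonneg hα this.1, mul_nonneg hβ this.2, mul_neg_of_pos_of_neg hγ hud]
        rw [hvan _ _ h1.1 h2.1, hvan _ _ h1.2 h2.2]
        · simp
        · rw [sub_sub_cancel_left, inner_neg_right, real_inner_smul_right, huτ]; simp
        · rw [add_sub_cancel_left, real_inner_smul_right, huτ]; simp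
      · have := mul_nonneg (hpos e he) (cutKernel_nonneg hd0 h1.1 h2.1)
        have := mul_nonneg (hpos e he) (cutKernel_nonneg hd0 h1.2 h2.2)
        linarith
    · have hs : z (s e) - x ≠ 0 := fun h =>
        hx (by rw [← sub_eq_zero.1 h]; exact left_mem_segment ℝ _ _)
      have ht : z (t e) - x ≠ 0 := fun h =>
        hx (by rw [← sub_eq_zero.1 h]; exact right_mem_segment ℝ _ _)
      have := eventually_cutKernel_add_eq hd0 (hslit _ hs) (hslit _ ht) hx τ
      filter_upwards [nhdsWithin_le_nhds this] with r hr
      rw [← mul_add, hr]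
      linarith
  filter_upwards [hev] with r hr
  rw [airy_eq_sum_cutKernel hω d, airy_eq_sum_cutKernel hω d, airy_eq_sum_cutKernel hω d,
    Finset.mul_sum, ← Finset.sum_add_distrib]
  exact Finset.sum_le_sum fun e _ => hr e

variable (z s t) in
/-- At every point of the plane, the bars of `F` through that point lie in a closed half-plane
bounded by a line through it. Plane pointed graphs have this property. -/
def LocallyOneSided (F : Set E) : Prop :=
  ∀ x : ℂ, ∃ u : ℂ, u ≠ 0 ∧ ∀ e ∈ F, x ∈ segment ℝ (z (s e)) (z (t e)) →
    0 ≤ inner ℝ u (z (s e) - x) ∧ 0 ≤ inner ℝ u (z (t e) - x)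

/-- Maximum principle: the Airy function of a stress that is nonnegative off a pointed plane graph
is nonpositive. -/
theorem airy_nonpos {ω : E → ℝ} (hω : IsStress z s t ω) {F : Set E}
    (hpos : ∀ e, e ∉ F → 0 ≤ ω e) (hF : LocallyOneSided z s t F) (x : ℂ) :
    airy z s t ω x ≤ 0 := by
  by_contra! hx
  obtain ⟨R, hR⟩ := airy_eq_zero_of_norm_lt hω
  have hball : ∀ y, 0 < airy z s t ω y → y ∈ Metric.closedBall (0 : ℂ) R := by
    intro y hy
    rw [mem_closedBall_zero_iff]
    by_contra! h
    exact hy.ne' (hR y h)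
  obtain ⟨m, -, hm⟩ := (isCompact_closedBall (0 : ℂ) R).exists_isMaxOn ⟨x, hball x hx⟩
    (continuous_airy (z := z) (s := s) (t := t) ω).continuousOn
  have hM : 0 < airy z s t ω m := hx.trans_le (hm (hball x hx))
  have hmax : ∀ y, airy z s t ω y ≤ airy z s t ω m := by
    intro y
    by_cases hy : 0 < airy z s t ω y
    · exact hm (hball y hy)
    · linarith
  have hcl : IsClosed {y | airy z s t ω y = airy z s t ω m} :=
    isClosed_eq (continuous_airy ω) continuous_const
  have hcpt : IsCompact {y | airy z s t ω y = airy z s t ω m} :=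
    (isCompact_closedBall (0 : ℂ) R).of_isClosed_subset hcl fun y hy =>
      hball y (hM.trans_eq (Eq.symm hy))
  obtain ⟨y, hy, hfar⟩ := hcpt.exists_isMaxOn ⟨m, rfl⟩ continuous_norm.continuousOn
  have hy : airy z s t ω y = airy z s t ω m := hy
  obtain ⟨u, hu, hFu⟩ := hF y
  obtain ⟨r, hr, hr0⟩ := ((eventually_two_mul_airy_le hω hpos hu hFu).and
    self_mem_nhdsWithin).exists
  have hr0 : r ≠ 0 := hr0
  set τ := r • (Complex.I * u)
  have hτ : τ ≠ 0 := smul_ne_zero hr0 (mul_ne_zero Complex.I_ne_zero hu)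
  have h1 := hmax (y + τ)
  have h2 := hmax (y - τ)
  have g1 : ‖y + τ‖ ≤ ‖y‖ := hfar (show airy z s t ω (y + τ) = airy z s t ω m by linarith)
  have g2 : ‖y - τ‖ ≤ ‖y‖ := hfar (show airy z s t ω (y - τ) = airy z s t ω m by linarith)
  have hp := parallelogram_law_with_norm ℝ y τ
  have := norm_pos_iff.2 hτ
  nlinarith [norm_nonneg (y + τ), norm_nonneg (y - τ), norm_nonneg y]

/-- The weight of a bar can be read off from the crease of the Airy function along it. -/
theorem exists_airy_second_difference (e : E) {x : ℂ}
    (hx : x ∈ openSegment ℝ (z (s e)) (z (t e))) (hs : z (s e) - x ≠ 0) (ht : z (t e) - x ≠ 0)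
    (hother : ∀ f, f ≠ e → x ∉ segment ℝ (z (s f)) (z (t f))) :
    ∃ (y w : ℂ) (c : ℝ), 0 < c ∧ ∀ ω : E → ℝ, IsStress z s t ω →
      airy z s t ω y + airy z s t ω w - 2 * airy z s t ω x = c * ω e := by
  obtain ⟨d, hud, hd⟩ := exists_generic_direction (fun i => z i - x) (one_ne_zero (α := ℂ))
  have hd0 : d ≠ 0 := by rintro rfl; simp at hud
  have hslit : ∀ i, z i - x ≠ 0 → ∀ r : ℝ,
      -((z i - (x + r • d)) * starRingEnd ℂ d) ∈ Complex.slitPlane := by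
    intro i hi r
    rw [Complex.mem_slitPlane_iff, im_neg_mul_conj]
    have : cross d (z i - (x + r • d)) = cross d (z i - x) := by simp [cross_def]; ring
    rw [this]
    exact Or.inr (neg_ne_zero.2 (hd i hi))
  have hslit' : ∀ i, z i - x ≠ 0 → ∀ r : ℝ,
      -((z i - (x - r • d)) * starRingEnd ℂ d) ∈ Complex.slitPlane := by
    intro i hi r
    have := hslit i hi (-r)
    rwa [neg_smul, ← sub_eq_add_neg] at this
  have hev : ∀ᶠ r : ℝ in nhds 0, ∀ f, f ≠ e →
      cutKernel d (z (s f) - (x + r • d)) (z (t f) - (x + r • d))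
        + cutKernel d (z (s f) - (x - r • d)) (z (t f) - (x - r • d))
        = 2 * cutKernel d (z (s f) - x) (z (t f) - x) := by
    rw [Filter.eventually_all]
    intro f
    rw [Filter.eventually_imp_distrib_left]
    intro hf
    have hxf := hother f hf
    have hs : z (s f) - x ≠ 0 := fun h =>
      hxf (by rw [← sub_eq_zero.1 h]; exact left_mem_segment ℝ _ _)
    have ht : z (t f) - x ≠ 0 := fun h =>
      hxf (by rw [← sub_eq_zero.1 h]; exact right_mem_segment ℝ _ _)
    refine eventually_cutKernel_add_eq hd0 ?_ ?_ hxf d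
    · simpa using hslit _ hs 0
    · simpa using hslit _ ht 0
  obtain ⟨r, hr, hr0⟩ := ((hev.filter_mono nhdsWithin_le_nhds).and
    (self_mem_nhdsWithin (s := Set.Ioi (0 : ℝ)))).exists
  have hr0 : 0 < r := hr0
  have h0 : cutKernel d (z (s e) - x) (z (t e) - x) = 0 := by
    rw [cutKernel, cross_eq_zero_of_mem_segment (openSegment_subset_segment ℝ _ _ hx), zero_mul]
  have hplus := cutKernel_nonneg hd0 (hslit _ hs r) (hslit _ ht r)
  have hminus : 0 < cutKernel d (z (s e) - (x - r • d)) (z (t e) - (x - r • d)) := by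
    refine lt_of_le_of_ne (cutKernel_nonneg hd0 (hslit' _ hs r) (hslit' _ ht r)) (Ne.symm ?_)
    obtain ⟨α, β, hα, hβ, hαβ, h⟩ := hx
    refine cutKernel_ne_zero_of_pos_combination hd0 hα hβ hr0 ?_ ?_
    · have : α • (z (s e) - (x - r • d)) + β • (z (t e) - (x - r • d))
          = (α • z (s e) + β • z (t e)) - (α + β) • (x - r • d) := by
        simp only [smul_sub, add_smul]; abel
      rw [this, h, hαβ, one_smul, sub_sub_cancel]
    · have : cross (z (s e) - (x - r • d)) d = -cross d (z (s e) - x) := by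
        simp [cross_def]; ring
      rw [this]
      exact neg_ne_zero.2 (hd _ hs)
  refine ⟨x + r • d, x - r • d, _, add_pos_of_nonneg_of_pos hplus hminus, fun ω hω => ?_⟩
  rw [airy_eq_sum_cutKernel hω d, airy_eq_sum_cutKernel hω d, airy_eq_sum_cutKernel hω d,
    Finset.mul_sum, ← Finset.sum_add_distrib, ← Finset.sum_sub_distrib,
    Finset.sum_eq_single e]
  · rw [h0]; ring
  · intro f _ hf
    linear_combination ω f * hr f hf
  · simp

end Maximum

/-- A point outside a convex cone of a finite-dimensional space is weakly separated from it. -/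
theorem exists_dual_nonpos_of_notMem {V : Type*} [NormedAddCommGroup V] [NormedSpace ℝ V]
    [FiniteDimensional ℝ V] {C : Set V} (hconv : Convex ℝ C) (h0 : (0 : V) ∈ C)
    (hsmul : ∀ r : ℝ, 0 ≤ r → ∀ g ∈ C, r • g ∈ C) {f : V} (hf : f ∉ C) :
    ∃ φ : V →ₗ[ℝ] ℝ, φ ≠ 0 ∧ (∀ g ∈ C, φ g ≤ 0) ∧ 0 ≤ φ f := by
  by_cases hspan : Submodule.span ℝ C = ⊤
  · have hint : (interior C).Nonempty := by
      rw [hconv.interior_nonempty_iff_affineSpan_eq_top,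
        AffineSubspace.affineSpan_eq_top_iff_vectorSpan_eq_top_of_nonempty ℝ V V ⟨0, h0⟩,
        vectorSpan_eq_span_vsub_set_right ℝ h0]
      simpa using hspan
    obtain ⟨φ, hne, hφ⟩ := geometric_hahn_banach_of_nonempty_interior_point hconv
      (fun h => hf (interior_subset h)) hint
    refine ⟨φ.toLinearMap, ?_, ?_, ?_⟩
    · intro h
      apply hne
      ext v
      exact LinearMap.congr_fun h v
    · intro g hg
      by_contra! hpos
      have hpos : 0 < φ g := hpos
      have h1 := hφ _ (hsmul ((|φ f| + 1) / φ g) (by positivity) g hg)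
      rw [map_smul, smul_eq_mul, div_mul_cancel₀ _ hpos.ne'] at h1
      linarith [le_abs_self (φ f)]
    · simpa using hφ 0 h0
  · obtain ⟨φ, hne, hφ⟩ := Submodule.exists_le_ker_of_lt_top _ (lt_top_iff_ne_top.2 hspan)
    have hker : ∀ g ∈ C, φ g = 0 := fun g hg => hφ (Submodule.subset_span hg)
    rcases le_total 0 (φ f) with h | h
    · exact ⟨φ, hne, fun g hg => (hker g hg).le, h⟩
    · exact ⟨-φ, neg_ne_zero.2 hne, fun g hg => by simp [hker g hg], by simpa using h⟩

section Rigidity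

variable {ι E : Type*} (z : ι → ℂ) (s t : E → ι)

/-- The rigidity map, sending an infinitesimal motion to the rates of change of the (halved
squared) bar lengths. -/
noncomputable def rigidityMap : (ι → ℂ) →ₗ[ℝ] (E → ℝ) where
  toFun v e := inner ℝ (z (s e) - z (t e)) (v (s e) - v (t e))
  map_add' v w := by
    ext e
    simp only [Pi.add_apply, add_sub_add_comm, inner_add_right]
  map_smul' r v := by
    ext e
    simp only [Pi.smul_apply, ← smul_sub, real_inner_smul_right, RingHom.id_apply, smul_eq_mul]

variable {z s t}

theorem rigidityMap_apply (v : ι → ℂ) (e : E) :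
    rigidityMap z s t v e = inner ℝ (z (s e) - z (t e)) (v (s e) - v (t e)) := rfl

variable (z s t) in
/-- The rigidity map of the framework with bars in `F` only. -/
noncomputable def rigidityMapOn (F : Set E) : (ι → ℂ) →ₗ[ℝ] (F → ℝ) :=
  (LinearMap.funLeft ℝ ℝ ((↑) : F → E)).comp (rigidityMap z s t)

theorem rigidityMapOn_apply {F : Set E} (v : ι → ℂ) (e : F) :
    rigidityMapOn z s t F v e = rigidityMap z s t v e := rfl

variable [Fintype E]

theorem linearMap_apply_eq_sum (φ : (E → ℝ) →ₗ[ℝ] ℝ) (g : E → ℝ) :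
    φ g = ∑ e, φ (Pi.single e 1) * g e := by
  conv_lhs => rw [LinearMap.pi_apply_eq_sum_univ φ g]
  refine Finset.sum_congr rfl fun e _ => ?_
  rw [smul_eq_mul, mul_comm]
  congr 2
  ext j
  simp [Pi.single_apply, eq_comm]

theorem isStress_of_forall_rigidityMap {φ : (E → ℝ) →ₗ[ℝ] ℝ}
    (h : ∀ v, φ (rigidityMap z s t v) = 0) : IsStress z s t fun e => φ (Pi.single e 1) := by
  intro v
  rw [← h v, linearMap_apply_eq_sum]
  rfl

variable (z s t) in
/-- The load `f` is negative on all nonzero stresses that are nonnegative off a locally one-sided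
set of bars. -/
def IsNegativeLoad (f : E → ℝ) : Prop :=
  ∀ (ω : E → ℝ) (F : Set E), IsStress z s t ω → (∀ e, e ∉ F → 0 ≤ ω e) →
    LocallyOneSided z s t F → ω ≠ 0 → ∑ e, ω e * f e < 0

theorem exists_isNegativeLoad [Fintype ι]
    (h : ∀ e, ∃ (x y w : ℂ) (c : ℝ), 0 < c ∧ ∀ ω : E → ℝ, IsStress z s t ω →
      airy z s t ω y + airy z s t ω w - 2 * airy z s t ω x = c * ω e) :
    ∃ f : E → ℝ, IsNegativeLoad z s t f := by
  choose x y w c hc hcrease using h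
  let k : E → ℂ → ℝ := fun e p => airyKernel (z (s e) - p) (z (t e) - p)
  refine ⟨fun e => ∑ e', (k e (x e') + k e (y e') + k e (w e')), fun ω F hω hpos hF hne => ?_⟩
  have hsum : ∑ e, ω e * ∑ e', (k e (x e') + k e (y e') + k e (w e'))
      = ∑ e', (airy z s t ω (x e') + airy z s t ω (y e') + airy z s t ω (w e')) := by
    simp only [airy, ← Finset.sum_add_distrib, Finset.mul_sum]
    rw [Finset.sum_comm]
    refine Finset.sum_congr rfl fun _ _ => Finset.sum_congr rfl fun _ _ => ?_
    simp only [k]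
    ring
  rw [hsum]
  have hle := airy_nonpos hω hpos hF
  obtain ⟨e, he⟩ := Function.ne_iff.1 hne
  refine Finset.sum_neg' (fun e' _ => by linarith [hle (x e'), hle (y e'), hle (w e')])
    ⟨e, Finset.mem_univ e, ?_⟩
  by_contra! h0
  have hx := hle (x e)
  have hy := hle (y e)
  have hw := hle (w e)
  have := hcrease e ω hω
  have h1 : c e * ω e = 0 := by linarith
  exact (mul_ne_zero (hc e).ne' he) h1

variable {f : E → ℝ} {F : Set E}

/-- Farkas' lemma for the face of the expansion polyhedron on which the bars of `F` are tight. -/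
theorem exists_expansive_motion (hf : IsNegativeLoad z s t f) (hF : LocallyOneSided z s t F) :
    ∃ v, (∀ e ∈ F, rigidityMap z s t v e = f e) ∧ ∀ e, f e ≤ rigidityMap z s t v e := by
  let R := rigidityMap z s t
  let C : Set (E → ℝ) := {g | ∃ v, (∀ e ∈ F, R v e = g e) ∧ ∀ e, g e ≤ R v e}
  by_contra hnot
  have hfC : f ∉ C := hnot
  have hconv : Convex ℝ C := by
    rintro g ⟨v, hv, hv'⟩ g' ⟨v', hw, hw'⟩ a b ha hb -
    refine ⟨a • v + b • v', fun e he => ?_, fun e => ?_⟩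
    · simp [hv e he, hw e he]
    · simp only [map_add, map_smul, Pi.add_apply, Pi.smul_apply, smul_eq_mul]
      exact add_le_add (mul_le_mul_of_nonneg_left (hv' e) ha)
        (mul_le_mul_of_nonneg_left (hw' e) hb)
  obtain ⟨φ, hne, hC, hφf⟩ := exists_dual_nonpos_of_notMem hconv ⟨0, by simp, by simp⟩
    (fun r hr g hg => by
      obtain ⟨v, hv, hv'⟩ := hg
      exact ⟨r • v, fun e he => by simp [hv e he], fun e => by
        simpa using mul_le_mul_of_nonneg_left (hv' e) hr⟩) hfC
  have hstress : IsStress z s t fun e => φ (Pi.single e 1) := by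
    refine isStress_of_forall_rigidityMap fun v =>
      le_antisymm (hC _ ⟨v, by simp [R], by simp [R]⟩) ?_
    have := hC _ ⟨-v, fun _ _ => rfl, fun _ => le_rfl⟩
    simpa [R] using this
  have hpos : ∀ e, e ∉ F → 0 ≤ φ (Pi.single e 1) := by
    intro e he
    have := hC (-Pi.single e 1) ⟨0, fun e' he' => ?_, fun e' => ?_⟩
    · simpa using this
    · have : e' ≠ e := fun h => he (h ▸ he')
      simp [this]
    · by_cases h : e' = e
      · subst h; simp
      · simp [h]
  have hω : (fun e => φ (Pi.single e 1)) ≠ 0 := by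
    intro h
    apply hne
    ext e
    exact congrFun h e
  have := hf _ F hstress hpos hF hω
  rw [← linearMap_apply_eq_sum] at this
  linarith

theorem rigidityMapOn_surjective (hf : IsNegativeLoad z s t f) (hF : LocallyOneSided z s t F) :
    Function.Surjective (rigidityMapOn z s t F) := by
  rw [← LinearMap.range_eq_top]
  by_contra htop
  obtain ⟨ψ, hne, hψ⟩ := Submodule.exists_le_ker_of_lt_top _ (lt_top_iff_ne_top.2 htop)
  let φ : (E → ℝ) →ₗ[ℝ] ℝ := ψ.comp (LinearMap.funLeft ℝ ℝ ((↑) : F → E))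
  have hstress : IsStress z s t fun e => φ (Pi.single e 1) :=
    isStress_of_forall_rigidityMap fun v => hψ (LinearMap.mem_range_self _ v)
  have hzero : ∀ e, e ∉ F → φ (Pi.single e 1) = 0 := by
    intro e he
    have : LinearMap.funLeft ℝ ℝ ((↑) : F → E) (Pi.single e 1) = 0 := by
      ext e'
      have : (e' : E) ≠ e := fun h => he (h ▸ e'.2)
      simp [LinearMap.funLeft_apply, this]
    simp only [φ, LinearMap.comp_apply, this, map_zero]
  have hω : (fun e => φ (Pi.single e 1)) ≠ 0 := by
    intro h
    apply hne
    ext e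
    have h1 := congrFun h e
    have : LinearMap.funLeft ℝ ℝ ((↑) : F → E) (Pi.single (e : E) 1) = Pi.single e 1 := by
      ext e'
      simp [LinearMap.funLeft_apply, Pi.single_apply, Subtype.ext_iff]
    simp only [φ, LinearMap.comp_apply, this] at h1
    simpa using h1
  have h1 := hf _ F hstress (fun e he => (hzero e he).ge) hF hω
  have h2 := hf (-fun e => φ (Pi.single e 1)) F
    (fun v => by simpa using hstress v) (fun e he => by simp [hzero e he]) hF (neg_ne_zero.2 hω)
  simp only [Pi.neg_apply, neg_mul, Finset.sum_neg_distrib] at h2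
  linarith

theorem card_add_finrank_ker [Fintype ι] (hf : IsNegativeLoad z s t f)
    (hF : LocallyOneSided z s t F) :
    Nat.card F + Module.finrank ℝ (rigidityMapOn z s t F).ker = 2 * Fintype.card ι := by
  have h := (rigidityMapOn z s t F).finrank_range_add_finrank_ker
  rw [LinearMap.range_eq_top.2 (rigidityMapOn_surjective hf hF)] at h
  rw [finrank_top, Module.finrank_fintype_fun_eq_card, Module.finrank_pi_fintype] at h
  rw [Nat.card_eq_fintype_card, h]
  simp [Complex.finrank_real_complex, mul_comm]

/-- A tight bar can be added as long as the framework has a nontrivial motion. -/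
theorem exists_expansive_motion_with_new_tight_bar (hf : IsNegativeLoad z s t f)
    (hF : LocallyOneSided z s t F) {w : ι → ℂ} (hw : ∀ e ∈ F, rigidityMap z s t w e = 0)
    (hw0 : rigidityMap z s t w ≠ 0) :
    ∃ v, (∀ e ∈ F, rigidityMap z s t v e = f e) ∧ (∀ e, f e ≤ rigidityMap z s t v e) ∧
      ∃ e, e ∉ F ∧ rigidityMap z s t v e = f e := by
  let R := rigidityMap z s t
  wlog hneg : ∃ e, R w e < 0 generalizing w
  · refine this (w := -w) (fun e he => by simp [hw e he]) (by simpa using hw0) ?_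
    push Not at hneg
    obtain ⟨e, he⟩ := Function.ne_iff.1 hw0
    exact ⟨e, by simpa [R] using lt_of_le_of_ne (hneg e) (Ne.symm he)⟩
  obtain ⟨v, hv, hv'⟩ := exists_expansive_motion hf hF
  obtain ⟨e₀, he₀⟩ := hneg
  obtain ⟨e, he, hmin⟩ := Finset.exists_min_image (Finset.univ.filter fun e => R w e < 0)
    (fun e => (R v e - f e) / (-R w e)) ⟨e₀, by simpa using he₀⟩
  have he : R w e < 0 := by simpa using he
  have hmin : ∀ e', R w e' < 0 → (R v e - f e) / (-R w e) ≤ (R v e' - f e') / (-R w e') :=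
    fun e' he' => hmin e' (by simpa using he')
  set r := (R v e - f e) / (-R w e) with hr
  have hr0 : 0 ≤ r := div_nonneg (sub_nonneg.2 (hv' e)) (by linarith)
  have happ : ∀ e', rigidityMap z s t (v + r • w) e' = R v e' + r * R w e' := fun e' => by
    simp [R]
  refine ⟨v + r • w, fun e' he' => ?_, fun e' => ?_, e, fun heF => he.ne (hw e heF), ?_⟩
  · have h1 : R v e' = f e' := hv e' he'
    have h2 : R w e' = 0 := hw e' he'
    rw [happ, h1, h2]; ring
  · have h1 : f e' ≤ R v e' := hv' e'
    rw [happ]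
    by_cases h : R w e' < 0
    · have := hmin e' h
      rw [le_div_iff₀ (by linarith)] at this
      linarith
    · nlinarith [mul_nonneg hr0 (not_lt.1 h)]
  · rw [happ, hr, div_neg, neg_mul, div_mul_cancel₀ _ he.ne]
    ring

/-- Stresses that are nonnegative off the tight bars of an expansive motion have nonpositive
load. -/
theorem sum_mul_load_nonpos {v : ι → ℂ} (hv : ∀ e, f e ≤ rigidityMap z s t v e) {ω : E → ℝ}
    (hω : IsStress z s t ω) (hpos : ∀ e, rigidityMap z s t v e ≠ f e → 0 ≤ ω e) :
    ∑ e, ω e * f e ≤ 0 := by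
  rw [← hω v]
  refine Finset.sum_le_sum fun e _ => ?_
  rw [← rigidityMap_apply]
  by_cases h : rigidityMap z s t v e = f e
  · rw [h]
  · exact mul_le_mul_of_nonneg_left (hv e) (hpos e h)

end Rigidity

/-- Pairs of distinct vertices, listed in increasing order: the bars of the complete framework. -/
abbrev OrdPair (ι : Type*) [LT ι] := {p : ι × ι // p.1 < p.2}

namespace OrdPair

variable {ι : Type*} [LinearOrder ι]

/-- The smaller vertex. -/
abbrev fst (e : OrdPair ι) : ι := e.1.1

/-- The larger vertex. -/
abbrev snd (e : OrdPair ι) : ι := e.1.2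

/-- The bar `e` joins the vertices `i` and `j`. -/
def Joins (e : OrdPair ι) (i j : ι) : Prop := (e.fst = i ∧ e.snd = j) ∨ (e.fst = j ∧ e.snd = i)

theorem fst_ne_snd (e : OrdPair ι) : e.fst ≠ e.snd := e.2.ne

theorem joins_self (e : OrdPair ι) : e.Joins e.fst e.snd := Or.inl ⟨rfl, rfl⟩

theorem Joins.symm {e : OrdPair ι} {i j : ι} (h : e.Joins i j) : e.Joins j i := Or.symm h

theorem Joins.ne {e : OrdPair ι} {i j : ι} (h : e.Joins i j) : i ≠ j := by
  rcases h with ⟨rfl, rfl⟩ | ⟨rfl, rfl⟩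
  · exact e.fst_ne_snd
  · exact e.fst_ne_snd.symm

theorem exists_joins {i j : ι} (h : i ≠ j) : ∃ e : OrdPair ι, e.Joins i j := by
  rcases lt_or_gt_of_ne h with h | h
  · exact ⟨⟨(i, j), h⟩, Or.inl ⟨rfl, rfl⟩⟩
  · exact ⟨⟨(j, i), h⟩, Or.inr ⟨rfl, rfl⟩⟩

theorem Joins.eq {e f : OrdPair ι} {i j : ι} (he : e.Joins i j) (hf : f.Joins i j) : e = f := by
  have h1 := e.2
  have h2 := f.2
  rcases he with ⟨h3, h4⟩ | ⟨h3, h4⟩ <;> rcases hf with ⟨h5, h6⟩ | ⟨h5, h6⟩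
  · exact Subtype.ext (Prod.ext (h3.trans h5.symm) (h4.trans h6.symm))
  · rw [fst] at *
    rw [snd] at *
    rw [h3, h4] at h1
    rw [h5, h6] at h2
    exact absurd h1 h2.asymm
  · rw [fst] at *
    rw [snd] at *
    rw [h3, h4] at h1
    rw [h5, h6] at h2
    exact absurd h1 h2.asymm
  · exact Subtype.ext (Prod.ext (h3.trans h5.symm) (h4.trans h6.symm))

theorem Joins.mul_eq {e : OrdPair ι} {i j : ι} (h : e.Joins i j) (l : ι → ℝ) :
    l e.fst * l e.snd = l i * l j := by
  rcases h with ⟨h, h'⟩ | ⟨h, h'⟩ <;> rw [h, h']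
  exact mul_comm _ _

theorem sum_eq_two_mul [Fintype ι] {g : ι → ι → ℝ} (hsymm : ∀ i j, g i j = g j i)
    (hdiag : ∀ i, g i i = 0) : ∑ i, ∑ j, g i j = 2 * ∑ e : OrdPair ι, g e.fst e.snd := by
  have hlt : ∑ e : OrdPair ι, g e.fst e.snd = ∑ i, ∑ j, if i < j then g i j else 0 := by
    rw [← Fintype.sum_prod_type', ← Finset.sum_filter, ← Finset.sum_subtype_eq_sum_filter]
    simp [Finset.subtype_univ]
  have hgt : ∑ e : OrdPair ι, g e.fst e.snd = ∑ i, ∑ j, if j < i then g i j else 0 := by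
    rw [hlt, Finset.sum_comm]
    simp only [hsymm]
  rw [two_mul]
  nth_rewrite 1 [hlt]
  rw [hgt, ← Finset.sum_add_distrib]
  refine Finset.sum_congr rfl fun i _ => ?_
  rw [← Finset.sum_add_distrib]
  refine Finset.sum_congr rfl fun j _ => ?_
  rcases lt_trichotomy i j with h | rfl | h
  · simp [h, h.asymm]
  · simp [hdiag]
  · simp [h, h.asymm]

end OrdPair

/-- No three of the points are collinear. -/
def NoThreeCollinear {ι : Type*} (z : ι → ℂ) : Prop :=
  ∀ i j k, i ≠ j → i ≠ k → j ≠ k → cross (z j - z i) (z k - z i) ≠ 0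

section Configuration

variable {ι : Type*} [LinearOrder ι] {z : ι → ℂ}

theorem exists_mem_openSegment_forall_notMem [Finite ι] (hz : NoThreeCollinear z)
    (e : OrdPair ι) : ∃ r ∈ Set.Ioo (0 : ℝ) 1, ∀ f : OrdPair ι, f ≠ e →
      z e.fst + r • (z e.snd - z e.fst) ∉ segment ℝ (z f.fst) (z f.snd) := by
  have hsub : ∀ f : OrdPair ι, f ≠ e → Set.Subsingleton
      {r : ℝ | z e.fst + r • (z e.snd - z e.fst) ∈ segment ℝ (z f.fst) (z f.snd)} := by
    intro f hf r hr r' hr'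
    by_contra hne
    have key : ∀ k l, f.Joins k l → k ≠ e.fst → k ≠ e.snd → False := by
      intro k l hkl hi hj
      have hseg : segment ℝ (z f.fst) (z f.snd) = segment ℝ (z k) (z l) := by
        rcases hkl with ⟨h, h'⟩ | ⟨h, h'⟩ <;> rw [h, h']
        exact segment_symm _ _ _
      have hline : ∀ q : ℝ, z e.fst + q • (z e.snd - z e.fst) ∈ segment ℝ (z k) (z l) →
          cross (z l - z k) (z e.fst - z k) + q * cross (z l - z k) (z e.snd - z e.fst) = 0 := by
        rintro q ⟨a, b, -, -, hab, h⟩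
        have h1 : z e.fst - z k + q • (z e.snd - z e.fst) = b • (z l - z k) := by
          have : a = 1 - b := by linarith
          subst this
          rw [sub_add_eq_add_sub, ← h]
          module
        have h2 := congrArg (cross (z l - z k)) h1
        simp only [cross_def, Complex.add_re, Complex.add_im, Complex.sub_re, Complex.sub_im,
          Complex.real_smul, Complex.mul_re, Complex.mul_im, Complex.ofReal_re,
          Complex.ofReal_im] at h2 ⊢
        linear_combination h2
      rw [Set.mem_ofPred_eq, hseg] at hr hr'
      have h1 := hline r hr
      have h2 := hline r' hr'
      have h3 : cross (z l - z k) (z e.snd - z e.fst) = 0 := by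
        have : (r - r') * cross (z l - z k) (z e.snd - z e.fst) = 0 := by linear_combination h1 - h2
        exact (mul_eq_zero.1 this).resolve_left (sub_ne_zero.2 hne)
      have h4 : cross (z l - z k) (z e.fst - z k) = 0 := by simpa [h3] using h1
      by_cases hl : l = e.fst
      · refine hz k l e.snd hkl.ne hj (hl ▸ e.fst_ne_snd) ?_
        have : cross (z l - z k) (z e.snd - z k)
            = cross (z l - z k) (z e.fst - z k) + cross (z l - z k) (z e.snd - z e.fst) := by
          simp only [cross_def, Complex.sub_re, Complex.sub_im]
          ring
        rw [this, h3, h4, add_zero]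
      · exact hz k l e.fst hkl.ne hi hl h4
    by_cases h1 : f.fst = e.fst ∨ f.fst = e.snd
    · by_cases h2 : f.snd = e.fst ∨ f.snd = e.snd
      · have hf' := f.fst_ne_snd
        refine hf (OrdPair.Joins.eq (i := e.fst) (j := e.snd) ?_ e.joins_self)
        rcases h1 with h1 | h1 <;> rcases h2 with h2 | h2
        · exact absurd (h1.trans h2.symm) hf'
        · exact Or.inl ⟨h1, h2⟩
        · exact Or.inr ⟨h1, h2⟩
        · exact absurd (h1.trans h2.symm) hf'
      · push Not at h2
        exact key _ _ f.joins_self.symm h2.1 h2.2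
    · push Not at h1
      exact key _ _ f.joins_self h1.1 h1.2
  have hfin : (⋃ f ∈ {f : OrdPair ι | f ≠ e},
      {r : ℝ | z e.fst + r • (z e.snd - z e.fst) ∈ segment ℝ (z f.fst) (z f.snd)}).Finite :=
    Set.Finite.biUnion (Set.toFinite _) fun f hf => (hsub f hf).finite
  obtain ⟨r, hr, hr'⟩ := (Set.Ioo_infinite (zero_lt_one' ℝ)).exists_notMem_finite hfin
  refine ⟨r, hr, fun f hf h => hr' ?_⟩
  simp only [Set.mem_iUnion]
  exact ⟨f, hf, h⟩

variable [Fintype ι]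

theorem exists_isNegativeLoad_ordPair (hinj : Function.Injective z) (hz : NoThreeCollinear z) :
    ∃ f, IsNegativeLoad z OrdPair.fst OrdPair.snd f := by
  refine exists_isNegativeLoad fun e => ?_
  obtain ⟨r, ⟨hr0, hr1⟩, hr⟩ := exists_mem_openSegment_forall_notMem hz e
  have hd : z e.snd - z e.fst ≠ 0 := sub_ne_zero.2 (hinj.ne e.fst_ne_snd.symm)
  refine ⟨z e.fst + r • (z e.snd - z e.fst), exists_airy_second_difference e ?_ ?_ ?_ hr⟩
  · exact ⟨1 - r, r, by linarith, hr0, by ring, by module⟩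
  · rw [sub_add_cancel_left, neg_ne_zero]
    exact smul_ne_zero hr0.ne' hd
  · have : z e.snd - (z e.fst + r • (z e.snd - z e.fst)) = (1 - r) • (z e.snd - z e.fst) := by
      module
    rw [this]
    exact smul_ne_zero (by linarith) hd

/-- An affine dependence of the points induces a rank-one stress. -/
theorem isStress_of_affine_dependence {l : ι → ℝ} (h0 : ∑ i, l i = 0)
    (h1 : ∑ i, l i • z i = 0) :
    IsStress z OrdPair.fst OrdPair.snd fun e => l e.fst * l e.snd := by
  intro v
  have hsum := OrdPair.sum_eq_two_mul (ι := ι)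
    (g := fun i j => l i * l j * inner ℝ (z i - z j) (v i - v j))
    (fun i j => by
      rw [← neg_sub (z j), ← neg_sub (v j), inner_neg_neg]; ring) (fun i => by simp)
  have hexp : ∑ i, ∑ j, l i * l j * inner ℝ (z i - z j) (v i - v j)
      = 2 * (∑ i, l i) * (∑ i, l i * inner ℝ (z i) (v i))
        - 2 * inner ℝ (∑ i, l i • z i) (∑ i, l i • v i) := by
    have hA : ∑ i, ∑ j, l i * l j * inner ℝ (z i) (v i)
        = (∑ i, l i) * (∑ i, l i * inner ℝ (z i) (v i)) := by
      rw [Finset.sum_comm, Finset.sum_mul_sum]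
      exact Finset.sum_congr rfl fun _ _ => Finset.sum_congr rfl fun _ _ => by ring
    have hB : ∑ i, ∑ j, l i * l j * inner ℝ (z j) (v j)
        = (∑ i, l i) * (∑ i, l i * inner ℝ (z i) (v i)) := by
      rw [Finset.sum_mul_sum]
      exact Finset.sum_congr rfl fun _ _ => Finset.sum_congr rfl fun _ _ => by ring
    have hC : ∑ i, ∑ j, l i * l j * inner ℝ (z i) (v j)
        = inner ℝ (∑ i, l i • z i) (∑ i, l i • v i) := by
      simp only [sum_inner, inner_sum, real_inner_smul_left, real_inner_smul_right]
      rw [Finset.sum_comm]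
      exact Finset.sum_congr rfl fun _ _ => Finset.sum_congr rfl fun _ _ => by ring
    have hD : ∑ i, ∑ j, l i * l j * inner ℝ (z j) (v i)
        = inner ℝ (∑ i, l i • z i) (∑ i, l i • v i) := by
      rw [← hC, Finset.sum_comm]
      exact Finset.sum_congr rfl fun _ _ => Finset.sum_congr rfl fun _ _ => by ring
    have : ∀ i j, l i * l j * inner ℝ (z i - z j) (v i - v j)
        = l i * l j * inner ℝ (z i) (v i) + l i * l j * inner ℝ (z j) (v j)
          - l i * l j * inner ℝ (z i) (v j) - l i * l j * inner ℝ (z j) (v i) := by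
      intro i j
      simp only [inner_sub_left, inner_sub_right]
      ring
    simp only [this, Finset.sum_sub_distrib, Finset.sum_add_distrib, hA, hB, hC, hD]
    ring
  rw [h0, h1, inner_zero_left] at hexp
  linarith

end Configuration

theorem inner_I_mul (a b : ℂ) : inner ℝ (Complex.I * a) b = cross a b := by
  simp [cross_def]
  ring

theorem cross_sub_eq_of_mem_segment {p q x : ℂ} (hx : x ∈ segment ℝ p q) (w : ℂ) :
    cross (q - p) (w - x) = cross (q - p) (w - p) := by
  obtain ⟨α, β, -, -, h, rfl⟩ := hx
  have : α = 1 - β := by linarith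
  subst this
  simp [cross_def]
  ring

theorem exists_fun_supported_on_four {ι : Type*} [Fintype ι] {a b c d : ι} (hab : a ≠ b)
    (hac : a ≠ c) (had : a ≠ d) (hbc : b ≠ c) (hbd : b ≠ d) (hcd : c ≠ d) (p q r s : ℝ) :
    ∃ l : ι → ℝ, l a = p ∧ l b = q ∧ l c = r ∧ l d = s ∧
      (∀ m, m ≠ a → m ≠ b → m ≠ c → m ≠ d → l m = 0) ∧ ∑ m, l m = p + q + r + s ∧
      ∀ z : ι → ℂ, ∑ m, l m • z m = p • z a + q • z b + r • z c + s • z d := by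
  refine ⟨Pi.single a p + Pi.single b q + Pi.single c r + Pi.single d s, ?_, ?_, ?_, ?_, ?_, ?_, ?_⟩
  · simp [hab, hac, had]
  · simp [hab.symm, hbc, hbd]
  · simp [hac.symm, hbc.symm, hcd]
  · simp [had.symm, hbd.symm, hcd.symm]
  · intro m ha hb hc hd
    simp [ha, hb, hc, hd]
  · simp [Finset.sum_add_distrib]
  · intro z
    simp [add_smul, Finset.sum_add_distrib, Pi.single_apply, ite_smul]

theorem disjoint_openSegment_of_common_endpoint {ι : Type*} {z : ι → ℂ}
    (hz : NoThreeCollinear z) {a b c : ι}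
    (hab : a ≠ b) (hac : a ≠ c) (hbc : b ≠ c) {x : ℂ} (hx : x ∈ segment ℝ (z a) (z b))
    (hx' : x ∈ openSegment ℝ (z a) (z c)) : False := by
  obtain ⟨p, q, -, -, h, rfl⟩ := hx
  obtain ⟨p', q', -, hq', h', hx⟩ := hx'
  have hp : p = 1 - q := by linarith
  have hp' : p' = 1 - q' := by linarith
  subst hp hp'
  have h1 : q' • (z c - z a) = q • (z b - z a) := by
    linear_combination (norm := module) hx
  have h2 := congrArg (cross (z b - z a)) h1
  have h3 : q' * cross (z b - z a) (z c - z a) = 0 := by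
    simp only [cross_def, Complex.real_smul, Complex.mul_re, Complex.mul_im, Complex.ofReal_re,
      Complex.ofReal_im] at h2 ⊢
    linear_combination h2
  exact hz a b c hab hac hbc ((mul_eq_zero.1 h3).resolve_left hq'.ne')

section Configuration

variable {ι : Type*} [LinearOrder ι] [Fintype ι] {z : ι → ℂ}

theorem locallyOneSided_of_affine_dependence (hinj : Function.Injective z) {l : ι → ℝ}
    (h0 : ∑ i, l i = 0) (h1 : ∑ i, l i • z i = 0) {F : Set (OrdPair ι)}
    (hF : ∀ e ∈ F, l e.fst ≠ 0 ∧ l e.snd ≠ 0)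
    (hopp : ∀ e ∈ F, ∃ j k, j ≠ k ∧ l j * l k < 0 ∧
      ∀ m, l m ≠ 0 → m = e.fst ∨ m = e.snd ∨ m = j ∨ m = k) :
    LocallyOneSided z OrdPair.fst OrdPair.snd F := by
  intro x
  by_cases hx : ∃ e ∈ F, x ∈ segment ℝ (z e.fst) (z e.snd)
  swap
  · push Not at hx
    exact ⟨1, one_ne_zero, fun e he h => absurd h (hx e he)⟩
  obtain ⟨e, he, hx⟩ := hx
  obtain ⟨j, k, hjk, hneg, hsupp⟩ := hopp e he
  set d := z e.snd - z e.fst with hd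
  have hd0 : d ≠ 0 := sub_ne_zero.2 (hinj.ne e.fst_ne_snd.symm)
  let g : ι → ℝ := fun m => cross d (z m - z e.fst)
  have hgs : g e.fst = 0 := by simp [g, cross_def]
  have hgt : g e.snd = 0 := by simp only [g, ← hd, cross_def]; ring
  have hg : ∀ m, inner ℝ (Complex.I * d) (z m - x) = g m := fun m => by
    rw [inner_I_mul, cross_sub_eq_of_mem_segment hx]
  have hsum : ∑ m, l m * g m = 0 := by
    have : ∀ m, l m * g m = inner ℝ (Complex.I * d) (l m • z m)
        - l m * inner ℝ (Complex.I * d) (z e.fst) := by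
      intro m
      simp only [g]
      rw [← inner_I_mul, inner_sub_right, real_inner_smul_right]
      ring
    simp only [this, Finset.sum_sub_distrib, ← inner_sum, ← Finset.sum_mul, h0, h1]
    simp
  have hsum' : l j * g j + l k * g k = 0 := by
    rw [← hsum]
    symm
    refine Fintype.sum_eq_add j k hjk fun m ⟨hj, hk⟩ => ?_
    by_cases hm : l m = 0
    · simp [hm]
    · rcases hsupp m hm with rfl | rfl | h | h
      · simp [hgs]
      · simp [hgt]
      · exact absurd h hj
      · exact absurd h hk
  have hprod : 0 ≤ g j * g k := by
    have h2 : l j * l k * (g j * g k) = -(l j * g j) ^ 2 := by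
      linear_combination (l j * g j) * hsum'
    by_contra! hlt
    nlinarith [mul_pos_of_neg_of_neg hneg hlt, sq_nonneg (l j * g j)]
  have hside : ∃ σ : ℝ, σ ≠ 0 ∧ 0 ≤ σ * g j ∧ 0 ≤ σ * g k := by
    rcases mul_nonneg_iff.1 hprod with h | h
    · exact ⟨1, one_ne_zero, by linarith, by linarith⟩
    · exact ⟨-1, by norm_num, by linarith, by linarith⟩
  obtain ⟨σ, hσ, hj, hk⟩ := hside
  have hall : ∀ m, l m ≠ 0 → 0 ≤ inner ℝ (σ • (Complex.I * d)) (z m - x) := by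
    intro m hm
    rw [real_inner_smul_left, hg]
    rcases hsupp m hm with rfl | rfl | rfl | rfl
    · simp [hgs]
    · simp [hgt]
    · exact hj
    · exact hk
  exact ⟨σ • (Complex.I * d), smul_ne_zero hσ (mul_ne_zero Complex.I_ne_zero hd0),
    fun f hf _ => ⟨hall _ (hF f hf).1, hall _ (hF f hf).2⟩⟩

variable {f : OrdPair ι → ℝ} {v : ι → ℂ}

/-- The rank-one stress (up to sign) of an affine dependence cannot be negative on tight bars
only. -/
theorem false_of_affine_dependence (hf : IsNegativeLoad z OrdPair.fst OrdPair.snd f)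
    (hv : ∀ e, f e ≤ rigidityMap z OrdPair.fst OrdPair.snd v e) (hinj : Function.Injective z)
    {l : ι → ℝ} (h0 : ∑ i, l i = 0) (h1 : ∑ i, l i • z i = 0) (σ : ℝ)
    (htight : ∀ e : OrdPair ι, σ * (l e.fst * l e.snd) < 0 →
      rigidityMap z OrdPair.fst OrdPair.snd v e = f e)
    (hopp : ∀ e : OrdPair ι, 0 < σ * (l e.fst * l e.snd) → ∃ j k, j ≠ k ∧ l j * l k < 0 ∧
      ∀ m, l m ≠ 0 → m = e.fst ∨ m = e.snd ∨ m = j ∨ m = k)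
    {i j : ι} (hij : i ≠ j) (hne : σ * (l i * l j) ≠ 0) : False := by
  have hs := isStress_of_affine_dependence h0 h1
  have hω : IsStress z OrdPair.fst OrdPair.snd
      fun e : OrdPair ι => σ * (l e.fst * l e.snd) := fun w => by
    have := hs w
    simp only [mul_assoc σ, ← Finset.mul_sum, this, mul_zero]
  have hω' : IsStress z OrdPair.fst OrdPair.snd
      fun e : OrdPair ι => -(σ * (l e.fst * l e.snd)) := fun w => by
    have := hω w
    simp only [neg_mul, Finset.sum_neg_distrib, this, neg_zero]
  have hle := sum_mul_load_nonpos hv hω fun e he => not_lt.1 fun h => he (htight e h)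
  have hone := locallyOneSided_of_affine_dependence hinj h0 h1
    (F := {e | 0 < σ * (l e.fst * l e.snd)})
    (fun e he => mul_ne_zero_iff.1 (right_ne_zero_of_mul (ne_of_gt he))) hopp
  have hlt := hf _ _ hω' (fun e he => by simpa using he) hone (by
    obtain ⟨e, he⟩ := OrdPair.exists_joins hij
    refine fun h => hne ?_
    rw [← he.mul_eq]
    simpa using congrFun h e)
  simp only [neg_mul, Finset.sum_neg_distrib] at hlt
  linarith

/-- Tight bars of an expansive motion do not cross. -/
theorem disjoint_openSegment_of_tight (hf : IsNegativeLoad z OrdPair.fst OrdPair.snd f)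
    (hv : ∀ e, f e ≤ rigidityMap z OrdPair.fst OrdPair.snd v e) (hinj : Function.Injective z)
    (hz : NoThreeCollinear z) {e e' : OrdPair ι} (hne : e ≠ e')
    (he : rigidityMap z OrdPair.fst OrdPair.snd v e = f e)
    (he' : rigidityMap z OrdPair.fst OrdPair.snd v e' = f e') {x : ℂ}
    (hx : x ∈ openSegment ℝ (z e.fst) (z e.snd))
    (hx' : x ∈ openSegment ℝ (z e'.fst) (z e'.snd)) : False := by
  have hab := e.fst_ne_snd
  have hcd := e'.fst_ne_snd
  by_cases hac : e.fst = e'.fst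
  · refine disjoint_openSegment_of_common_endpoint hz hab (hac ▸ hcd) (fun h => hne ?_)
      (openSegment_subset_segment _ _ _ hx) (hac ▸ hx')
    exact Subtype.ext (Prod.ext hac h)
  by_cases had : e.fst = e'.snd
  · refine disjoint_openSegment_of_common_endpoint hz hab hac (fun h => ?_)
      (openSegment_subset_segment _ _ _ hx) (had ▸ openSegment_symm ℝ (z e'.fst) _ ▸ hx')
    exact hne (OrdPair.Joins.eq e.joins_self (Or.inr ⟨h.symm, had.symm⟩))
  by_cases hbc : e.snd = e'.fst
  · refine disjoint_openSegment_of_common_endpoint hz hab.symm (hbc ▸ hcd) had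
      (segment_symm ℝ (z e.fst) _ ▸ openSegment_subset_segment _ _ _ hx) (hbc ▸ hx')
  by_cases hbd : e.snd = e'.snd
  · refine disjoint_openSegment_of_common_endpoint hz hab.symm hbc hac
      (segment_symm ℝ (z e.fst) _ ▸ openSegment_subset_segment _ _ _ hx)
      (hbd ▸ openSegment_symm ℝ (z e'.fst) _ ▸ hx')
  obtain ⟨p, q, hp, hq, hpq, rfl⟩ := hx
  obtain ⟨p', q', hp', hq', hpq', hx⟩ := hx'
  obtain ⟨l, ha, hb, hc, hd, hl, hsum, hz'⟩ :=
    exists_fun_supported_on_four hab hac had hbc hbd hcd p q (-p') (-q')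
  have hsupp : ∀ m, l m ≠ 0 → m = e.fst ∨ m = e.snd ∨ m = e'.fst ∨ m = e'.snd := by
    intro m hm
    by_contra! h
    exact hm (hl m h.1 h.2.1 h.2.2.1 h.2.2.2)
  have hpos : ∀ m, 0 < l m → m = e.fst ∨ m = e.snd := by
    intro m hm
    rcases hsupp m hm.ne' with h | h | h | h
    · exact Or.inl h
    · exact Or.inr h
    · rw [h, hc] at hm
      linarith
    · rw [h, hd] at hm
      linarith
  have hneg : ∀ m, l m < 0 → m = e'.fst ∨ m = e'.snd := by
    intro m hm
    rcases hsupp m hm.ne with h | h | h | h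
    · rw [h, ha] at hm
      linarith
    · rw [h, hb] at hm
      linarith
    · exact Or.inl h
    · exact Or.inr h
  have hpos' : ∀ m, 0 < l m → ∃ m', 0 < l m' ∧ ∀ x, 0 < l x → x = m ∨ x = m' := by
    intro m hm
    rcases hpos m hm with h | h
    · exact ⟨e.snd, hb ▸ hq, fun x hx => h ▸ hpos x hx⟩
    · exact ⟨e.fst, ha ▸ hp, fun x hx => h ▸ (hpos x hx).symm⟩
  have hneg' : ∀ m, l m < 0 → ∃ m', l m' < 0 ∧ ∀ x, l x < 0 → x = m ∨ x = m' := by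
    intro m hm
    rcases hneg m hm with h | h
    · exact ⟨e'.snd, by linarith, fun x hx => h ▸ hneg x hx⟩
    · exact ⟨e'.fst, by linarith, fun x hx => h ▸ (hneg x hx).symm⟩
  have hopp : ∀ i j, 0 < l i → l j < 0 → ∃ k k', k ≠ k' ∧ l k * l k' < 0 ∧
      ∀ m, l m ≠ 0 → m = i ∨ m = j ∨ m = k ∨ m = k' := by
    intro i j hi hj
    obtain ⟨k, hk, hik⟩ := hpos' i hi
    obtain ⟨k', hk', hjk⟩ := hneg' j hj
    refine ⟨k, k', fun h => ?_, mul_neg_of_pos_of_neg hk hk', fun m hm => ?_⟩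
    · rw [h] at hk
      exact hk.asymm hk'
    · rcases lt_or_gt_of_ne hm with h | h
      · have := hjk m h
        tauto
      · have := hik m h
        tauto
  have hpq' := mul_pos hp hq
  refine false_of_affine_dependence hf hv hinj (l := l) (by linarith) ?_ (-1) (fun g hg => ?_)
    (fun g hg => ?_) hab (by rw [ha, hb]; linarith)
  · rw [hz']
    linear_combination (norm := module) -hx
  · have hg' := g.fst_ne_snd
    rcases mul_pos_iff.1 (show 0 < l g.fst * l g.snd by linarith) with ⟨h, h'⟩ | ⟨h, h'⟩
    · rw [show g = e from OrdPair.Joins.eq (i := e.fst) (j := e.snd) ?_ e.joins_self]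
      · exact he
      have := hpos _ h
      have := hpos _ h'
      unfold OrdPair.Joins
      grind
    · rw [show g = e' from OrdPair.Joins.eq (i := e'.fst) (j := e'.snd) ?_ e'.joins_self]
      · exact he'
      have := hneg _ h
      have := hneg _ h'
      unfold OrdPair.Joins
      grind
  · rcases mul_neg_iff.1 (show l g.fst * l g.snd < 0 by linarith) with ⟨h, h'⟩ | ⟨h, h'⟩
    · exact hopp _ _ h h'
    · obtain ⟨k, k', hk, hk', hm⟩ := hopp _ _ h' h
      exact ⟨k, k', hk, hk', fun m hm' => by have := hm m hm'; tauto⟩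

end Configuration

theorem exists_forall_inner_pos {V : Type*} [NormedAddCommGroup V] [InnerProductSpace ℝ V]
    [FiniteDimensional ℝ V] {S : Set V} (hS : S.Finite) (h0 : (0 : V) ∉ convexHull ℝ S) :
    ∃ u : V, ∀ w ∈ S, 0 < inner ℝ u w := by
  obtain ⟨φ, c, hc, hφ⟩ := geometric_hahn_banach_point_closed (convex_convexHull ℝ S)
    (hS.isClosed_convexHull ℝ) h0
  refine ⟨(InnerProductSpace.toDual ℝ V).symm φ, fun w hw => ?_⟩
  rw [InnerProductSpace.toDual_symm_apply]
  rw [map_zero] at hc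
  exact hc.trans (hφ w (subset_convexHull ℝ S hw))

section Configuration

variable {ι : Type*} [LinearOrder ι] {z : ι → ℂ} {f : OrdPair ι → ℝ} {v : ι → ℂ}

theorem eq_zero_of_inner_eq_zero {a b w : ℂ} (hab : cross a b ≠ 0) (ha : inner ℝ a w = 0)
    (hb : inner ℝ b w = 0) : w = 0 := by
  rw [inner_eq_re_mul_add] at ha hb
  rw [cross_def] at hab
  apply Complex.ext
  · have : (a.re * b.im - a.im * b.re) * w.re = 0 := by linear_combination b.im * ha - a.im * hb
    exact (mul_eq_zero.1 this).resolve_left hab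
  · have : (a.re * b.im - a.im * b.re) * w.im = 0 := by linear_combination a.re * hb - b.re * ha
    exact (mul_eq_zero.1 this).resolve_left hab

theorem finrank_ker_rigidityMap_le (hinj : Function.Injective z) (hz : NoThreeCollinear z)
    {i j : ι} (hij : i ≠ j) :
    Module.finrank ℝ (rigidityMap z (OrdPair.fst (ι := ι)) OrdPair.snd).ker ≤ 3 := by
  let K : (ι → ℂ) →ₗ[ℝ] ℂ × ℝ :=
    LinearMap.prod (LinearMap.proj (R := ℝ) (φ := fun _ : ι => ℂ) i)
      ((innerₛₗ ℝ (Complex.I * (z j - z i))).comp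
        (LinearMap.proj (R := ℝ) (φ := fun _ : ι => ℂ) j - LinearMap.proj i))
  have hK : Function.Injective
      (K.domRestrict (rigidityMap z (OrdPair.fst (ι := ι)) OrdPair.snd).ker) := by
    rw [← LinearMap.ker_eq_bot, LinearMap.ker_eq_bot']
    rintro ⟨w, hw⟩ h
    have hi : w i = 0 := congrArg Prod.fst h
    have hj' : inner ℝ (Complex.I * (z j - z i)) (w j - w i) = 0 := congrArg Prod.snd h
    have hbar : ∀ k l, inner ℝ (z k - z l) (w k - w l) = 0 := by
      intro k l
      by_cases hkl : k = l
      · simp [hkl]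
      obtain ⟨e, he⟩ := OrdPair.exists_joins hkl
      have := congrFun (LinearMap.mem_ker.1 hw) e
      rw [rigidityMap_apply] at this
      rcases he with ⟨h, h'⟩ | ⟨h, h'⟩ <;> rw [h, h'] at this
      · exact this
      · rw [← neg_sub (z l), ← neg_sub (w l), inner_neg_neg]
        exact this
    have hd : z j - z i ≠ 0 := sub_ne_zero.2 (hinj.ne hij.symm)
    have hj : w j = 0 := by
      have h1 := eq_zero_of_inner_eq_zero ?_ (hbar j i) hj'
      · rwa [hi, sub_zero] at h1
      · rw [← inner_I_mul, real_inner_self_eq_norm_sq]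
        simpa using hd
    apply Subtype.ext
    funext k
    by_cases hki : k = i
    · exact hki ▸ hi
    by_cases hkj : k = j
    · exact hkj ▸ hj
    have h1 := hbar k i
    have h2 := hbar k j
    rw [hi, sub_zero] at h1
    rw [hj, sub_zero] at h2
    refine eq_zero_of_inner_eq_zero (fun h => hz k i j hki hkj hij ?_) h1 h2
    rw [cross_def] at h ⊢
    simp only [Complex.sub_re, Complex.sub_im] at h ⊢
    linear_combination h
  have := LinearMap.finrank_le_finrank_of_injective hK
  simpa [Complex.finrank_real_complex] using this

variable [Fintype ι]

/-- A convex combination of three tight directions at a vertex does not vanish. -/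
theorem false_of_three_tight (hf : IsNegativeLoad z OrdPair.fst OrdPair.snd f)
    (hv : ∀ e, f e ≤ rigidityMap z OrdPair.fst OrdPair.snd v e) (hinj : Function.Injective z)
    {i a b c : ι} (hab : a ≠ b) (hac : a ≠ c) (hbc : b ≠ c) {p q r : ℝ} (hp : 0 < p) (hq : 0 < q)
    (hr : 0 < r) (hsum : p + q + r = 1)
    (h : p • (z a - z i) + q • (z b - z i) + r • (z c - z i) = 0)
    (htight : ∀ e : OrdPair ι, e.Joins i a ∨ e.Joins i b ∨ e.Joins i c →
      rigidityMap z OrdPair.fst OrdPair.snd v e = f e) (hia : i ≠ a) (hib : i ≠ b)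
    (hic : i ≠ c) : False := by
  obtain ⟨l, hli, hla, hlb, hlc, hl, hl1, hz'⟩ :=
    exists_fun_supported_on_four hia hib hic hab hac hbc (-1) p q r
  have hsupp : ∀ m, l m ≠ 0 → m = i ∨ m = a ∨ m = b ∨ m = c := by
    intro m hm
    by_contra! h
    exact hm (hl m h.1 h.2.1 h.2.2.1 h.2.2.2)
  have hneg : ∀ m, l m < 0 → m = i := by
    intro m hm
    rcases hsupp m hm.ne with h | h | h | h
    · exact h
    all_goals
      rw [h] at hm
      linarith
  have hpos : ∀ m, 0 < l m → m = a ∨ m = b ∨ m = c := by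
    intro m hm
    rcases hsupp m hm.ne' with h | h
    · rw [h] at hm
      linarith
    · exact h
  have hpq := mul_pos hp hq
  have hli0 : l i < 0 := by linarith
  refine false_of_affine_dependence hf hv hinj (l := l) (by linarith) ?_ 1 (fun g hg => ?_)
    (fun g hg => ?_) hab (by rw [hla, hlb]; linarith)
  · rw [hz']
    have h1 : (-1 : ℝ) = -(p + q + r) := by linarith
    rw [h1]
    linear_combination (norm := module) h
  · refine htight g ?_
    rcases mul_neg_iff.1 (show l g.fst * l g.snd < 0 by linarith) with ⟨h, h'⟩ | ⟨h, h'⟩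
    · have h1 := hneg _ h'
      rcases hpos _ h with h2 | h2 | h2
      · exact Or.inl (Or.inr ⟨h2, h1⟩)
      · exact Or.inr (Or.inl (Or.inr ⟨h2, h1⟩))
      · exact Or.inr (Or.inr (Or.inr ⟨h2, h1⟩))
    · have h1 := hneg _ h
      rcases hpos _ h' with h2 | h2 | h2
      · exact Or.inl (Or.inl ⟨h1, h2⟩)
      · exact Or.inr (Or.inl (Or.inl ⟨h1, h2⟩))
      · exact Or.inr (Or.inr (Or.inl ⟨h1, h2⟩))
  · have hg' := g.fst_ne_snd
    rcases mul_pos_iff.1 (show 0 < l g.fst * l g.snd by linarith) with ⟨h, h'⟩ | ⟨h, h'⟩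
    · have hs := hpos _ h
      have ht := hpos _ h'
      have hk : ∃ k, k ≠ i ∧ 0 < l k ∧
          ∀ m, m = i ∨ m = a ∨ m = b ∨ m = c → m = g.fst ∨ m = g.snd ∨ m = i ∨ m = k := by
        by_cases ha : g.fst = a ∨ g.snd = a
        · by_cases hb : g.fst = b ∨ g.snd = b
          · exact ⟨c, hic.symm, hlc ▸ hr, by grind⟩
          · exact ⟨b, hib.symm, hlb ▸ hq, by grind⟩
        · exact ⟨a, hia.symm, hla ▸ hp, by grind⟩
      obtain ⟨k, hki, hk, hm⟩ := hk
      exact ⟨i, k, hki.symm, mul_neg_of_neg_of_pos hli0 hk, fun m hm' => hm m (hsupp m hm')⟩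
    · exact (hg' ((hneg _ h).trans (hneg _ h').symm)).elim

/-- The tight bars of an expansive motion form a pointed graph. -/
theorem exists_forall_tight_inner_pos (hf : IsNegativeLoad z OrdPair.fst OrdPair.snd f)
    (hv : ∀ e, f e ≤ rigidityMap z OrdPair.fst OrdPair.snd v e) (hinj : Function.Injective z)
    (hz : NoThreeCollinear z) (i : ι) :
    ∃ u : ℂ, ∀ (e : OrdPair ι) (j : ι), rigidityMap z OrdPair.fst OrdPair.snd v e = f e →
      e.Joins i j → 0 < inner ℝ u (z j - z i) := by
  let N : Set ι := {j | ∃ e : OrdPair ι, rigidityMap z OrdPair.fst OrdPair.snd v e = f e ∧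
    e.Joins i j}
  suffices h : (0 : ℂ) ∉ convexHull ℝ ((fun j => z j - z i) '' N) by
    obtain ⟨u, hu⟩ := exists_forall_inner_pos ((Set.toFinite N).image _) h
    exact ⟨u, fun e j he hj => hu _ ⟨j, ⟨e, he, hj⟩, rfl⟩⟩
  intro h0
  obtain ⟨κ, hκ, w, a, hw, haff, ha, ha1, hsum⟩ := eq_pos_convex_span_of_mem_convexHull h0
  have hcard : Fintype.card κ ≤ 3 := by
    refine haff.card_le_finrank_succ.trans ?_
    have := Submodule.finrank_le (vectorSpan ℝ (Set.range w))
    rw [Complex.finrank_real_complex] at this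
    omega
  have hw' : ∀ k, ∃ j ∈ N, z j - z i = w k := fun k => hw ⟨k, rfl⟩
  choose j hjN hj using hw'
  have hjinj : Function.Injective j := by
    intro k k' h
    apply haff.injective
    rw [← hj, ← hj, h]
  have hij : ∀ k, i ≠ j k := fun k => by
    obtain ⟨e, -, he⟩ := hjN k
    exact he.ne
  obtain ⟨φ⟩ : Nonempty (Fin (Fintype.card κ) ≃ κ) := ⟨(Fintype.equivFin κ).symm⟩
  rw [← φ.sum_comp] at ha1 hsum
  generalize Fintype.card κ = m at hcard φ ha1 hsum
  simp only [← hj] at hsum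
  have hne : ∀ x y, x ≠ y → j (φ x) ≠ j (φ y) := fun x y h => hjinj.ne (φ.injective.ne h)
  interval_cases m
  · simp at ha1
  · rw [Fin.sum_univ_one, smul_eq_zero, sub_eq_zero] at hsum
    rcases hsum with h | h
    · exact (ha _).ne' h
    · exact hij _ (hinj h).symm
  · rw [Fin.sum_univ_two] at hsum
    have h1 := congrArg (cross (z (j (φ 0)) - z i)) hsum
    have h2 : a (φ 1) * cross (z (j (φ 0)) - z i) (z (j (φ 1)) - z i) = 0 := by
      simp only [cross_def, Complex.add_re, Complex.add_im, Complex.real_smul, Complex.mul_re,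
        Complex.mul_im, Complex.ofReal_re, Complex.ofReal_im, Complex.zero_re,
        Complex.zero_im] at h1 ⊢
      linear_combination h1
    exact hz _ _ _ (hij _) (hij _) (hne 0 1 (by decide))
      ((mul_eq_zero.1 h2).resolve_left (ha _).ne')
  · rw [Fin.sum_univ_three] at hsum ha1
    refine false_of_three_tight hf hv hinj (hne 0 1 (by decide)) (hne 0 2 (by decide))
      (hne 1 2 (by decide)) (ha _) (ha _) (ha _) ha1 hsum ?_ (hij _) (hij _) (hij _)
    have key : ∀ (k : κ) (e : OrdPair ι), e.Joins i (j k) →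
        rigidityMap z OrdPair.fst OrdPair.snd v e = f e := by
      intro k e he
      obtain ⟨e', he', hj'⟩ := hjN k
      rwa [he.eq hj']
    rintro e (he | he | he) <;> exact key _ _ he

theorem three_le_finrank_ker_rigidityMapOn {i j : ι} (hij : z i ≠ z j) (F : Set (OrdPair ι)) :
    3 ≤ Module.finrank ℝ (rigidityMapOn z OrdPair.fst OrdPair.snd F).ker := by
  let L : ℂ × ℝ →ₗ[ℝ] (ι → ℂ) :=
    { toFun := fun p k => p.1 + p.2 • (Complex.I * z k)
      map_add' := fun p q => by
        ext1 k
        simp only [Prod.fst_add, Prod.snd_add, Pi.add_apply]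
        module
      map_smul' := fun r p => by
        ext1 k
        simp only [Prod.smul_fst, Prod.smul_snd, Pi.smul_apply, RingHom.id_apply]
        module }
  have hL : ∀ p, L p ∈ (rigidityMapOn z OrdPair.fst OrdPair.snd F).ker := by
    intro p
    rw [LinearMap.mem_ker]
    ext e
    rw [rigidityMapOn_apply, rigidityMap_apply]
    have : L p e.1.fst - L p e.1.snd = p.2 • (Complex.I * (z e.1.fst - z e.1.snd)) := by
      change p.1 + p.2 • (Complex.I * _) - (p.1 + p.2 • (Complex.I * _)) = _
      rw [mul_sub]
      module
    rw [this, real_inner_smul_right, real_inner_comm, inner_I_mul, cross_def,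
      mul_comm (Complex.re _)]
    simp
  have hinj : Function.Injective (L.codRestrict _ hL) := by
    rw [LinearMap.injective_codRestrict_iff, ← LinearMap.ker_eq_bot, LinearMap.ker_eq_bot']
    rintro ⟨c, r⟩ h
    have h1 : c + r • (Complex.I * z i) = 0 := congrFun h i
    have h2 : c + r • (Complex.I * z j) = 0 := congrFun h j
    have h3 : r • (Complex.I * (z i - z j)) = 0 := by
      rw [mul_sub]
      linear_combination (norm := module) h1 - h2
    have hr : r = 0 := (smul_eq_zero.1 h3).resolve_right
      (mul_ne_zero Complex.I_ne_zero (sub_ne_zero.2 hij))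
    subst hr
    simpa using h1
  have := LinearMap.finrank_le_finrank_of_injective hinj
  simpa [Complex.finrank_real_complex] using this

/-- A pointed plane framework with fewer than `2n - 3` bars is flexible. -/
theorem exists_nontrivial_motion (hinj : Function.Injective z) (hz : NoThreeCollinear z)
    {i j : ι} (hij : i ≠ j) {F : Set (OrdPair ι)}
    (hF : 3 < Module.finrank ℝ (rigidityMapOn z OrdPair.fst OrdPair.snd F).ker) :
    ∃ w, (∀ e ∈ F, rigidityMap z OrdPair.fst OrdPair.snd w e = 0) ∧
      rigidityMap z (OrdPair.fst (ι := ι)) OrdPair.snd w ≠ 0 := by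
  by_contra! h
  have hle : (rigidityMapOn z OrdPair.fst OrdPair.snd F).ker
      ≤ (rigidityMap z (OrdPair.fst (ι := ι)) OrdPair.snd).ker := by
    intro w hw
    exact h w fun e he => congrFun (LinearMap.mem_ker.1 hw) ⟨e, he⟩
  have := Submodule.finrank_mono hle
  have := finrank_ker_rigidityMap_le hinj hz hij
  omega

end Configuration

/-- The complex coordinate of a point of the plane. -/
noncomputable def complexCoord : Pt ≃ₗᵢ[ℝ] ℂ := Complex.orthonormalBasisOneI.repr.symm

theorem complexCoord_mem_openSegment {x p q : Pt} :
    complexCoord x ∈ openSegment ℝ (complexCoord p) (complexCoord q) ↔ x ∈ openSegment ℝ p q := by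
  have := image_openSegment ℝ complexCoord.toLinearEquiv.toLinearMap.toAffineMap p q
  change complexCoord '' _ = openSegment ℝ (complexCoord p) (complexCoord q) at this
  rw [← this, complexCoord.injective.mem_set_image]

theorem oseg_mk (p q : Pt) : oseg s(p, q) = openSegment ℝ p q := rfl

theorem collinear_of_cross_eq_zero {p q r : Pt} (hpq : p ≠ q)
    (h : cross (complexCoord q - complexCoord p) (complexCoord r - complexCoord p) = 0) :
    Collinear ℝ ({p, q, r} : Set Pt) := by
  rw [collinear_iff_of_mem (p₀ := p) (by simp)]
  rw [← map_sub, ← map_sub] at h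
  set a := q - p with ha
  set b := r - p with hb
  have ha0 : complexCoord a ≠ 0 := by
    rw [Ne, map_eq_zero_iff _ complexCoord.injective, ha, sub_eq_zero]
    exact hpq.symm
  have hab : b = (inner ℝ (complexCoord a) (complexCoord b)
      / Complex.normSq (complexCoord a)) • a := by
    apply complexCoord.injective
    rw [map_smul]
    have hn : Complex.normSq (complexCoord a) ≠ 0 := by simpa using ha0
    rw [cross_def] at h
    rw [inner_eq_re_mul_add, div_eq_inv_mul, mul_smul, eq_inv_smul_iff₀ hn]
    rw [Complex.normSq_apply]
    apply Complex.ext <;>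
      simp only [Complex.real_smul, Complex.mul_re, Complex.mul_im, Complex.ofReal_re,
        Complex.ofReal_im]
    · linear_combination -(complexCoord a).im * h
    · linear_combination (complexCoord a).re * h
  refine ⟨a, fun x hx => ?_⟩
  rcases hx with rfl | rfl | rfl
  · exact ⟨0, by simp⟩
  · exact ⟨1, by simp [ha]⟩
  · exact ⟨_, by rw [← hab, hb]; simp⟩

theorem PlaneGraph.edges_eq_empty {P : Finset Pt} (G : PlaneGraph P) (hP : P.card ≤ 1) :
    G.edges = ∅ := by
  rw [Finset.eq_empty_iff_forall_notMem]
  intro e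
  induction e using Sym2.ind with
  | _ p q =>
    intro he
    exact G.not_isDiag _ he (Finset.card_le_one.1 hP _ (G.endpoints_mem _ he p (by simp)) _
      (G.endpoints_mem _ he q (by simp)))

theorem GeneralPosition.noThreeCollinear {ι : Type*} {P : Finset Pt} {pt : ι → Pt}
    (hgen : GeneralPosition P) (hpt : Function.Injective pt) (hP : ∀ i, pt i ∈ P) :
    NoThreeCollinear fun i => complexCoord (pt i) :=
  fun i j k hij hik hjk h => hgen _ (hP i) _ (hP j) _ (hP k) (hpt.ne hij) (hpt.ne hik)
    (hpt.ne hjk) (collinear_of_cross_eq_zero (hpt.ne hij) h)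

theorem NoThreeCollinear.notMem_openSegment {ι : Type*} {z : ι → ℂ}
    (hz : NoThreeCollinear z) (hinj : Function.Injective z) {i j : ι} (hij : i ≠ j) (k : ι) :
    z k ∉ openSegment ℝ (z i) (z j) := by
  intro h
  have hne := hinj.ne hij
  by_cases hki : k = i
  · exact hne (left_mem_openSegment_iff.1 (hki ▸ h))
  by_cases hkj : k = j
  · exact hne (right_mem_openSegment_iff.1 (hkj ▸ h))
  exact hz k i j hki hkj hij (cross_eq_zero_of_mem_segment (openSegment_subset_segment _ _ _ h))

section Labelling

variable {ι : Type*} [LinearOrder ι] {P : Finset Pt} {pt : ι → Pt}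

variable (pt) in
/-- The segment represented by a bar, for a labelling `pt` of the vertices. -/
def OrdPair.edge (e : OrdPair ι) : Sym2 Pt := s(pt e.fst, pt e.snd)

theorem OrdPair.Joins.edge_eq {e : OrdPair ι} {i j : ι} (h : e.Joins i j) :
    e.edge pt = s(pt i, pt j) := by
  rcases h with ⟨h, h'⟩ | ⟨h, h'⟩ <;> rw [OrdPair.edge, h, h']
  exact Sym2.eq_swap

theorem OrdPair.joins_of_edge_eq (hpt : Function.Injective pt) {e : OrdPair ι} {i j : ι}
    (h : e.edge pt = s(pt i, pt j)) : e.Joins i j := by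
  rw [OrdPair.edge, Sym2.eq_iff] at h
  rcases h with ⟨h, h'⟩ | ⟨h, h'⟩
  · exact Or.inl ⟨hpt h, hpt h'⟩
  · exact Or.inr ⟨hpt h, hpt h'⟩

theorem OrdPair.edge_injective (hpt : Function.Injective pt) :
    Function.Injective (OrdPair.edge pt) := fun _ f h =>
  (joins_of_edge_eq hpt h).eq f.joins_self

theorem PlaneGraph.exists_edge_eq (G : PlaneGraph P) (hP : ∀ p ∈ P, ∃ i, pt i = p) {g : Sym2 Pt}
    (hg : g ∈ G.edges) : ∃ e : OrdPair ι, e.edge pt = g := by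
  induction g using Sym2.ind with
  | _ p q =>
    obtain ⟨i, rfl⟩ := hP p (G.endpoints_mem _ hg p (by simp))
    obtain ⟨j, rfl⟩ := hP q (G.endpoints_mem _ hg q (by simp))
    obtain ⟨e, he⟩ := OrdPair.exists_joins (i := i) (j := j)
      fun h => G.not_isDiag _ hg (congrArg pt h)
    exact ⟨e, he.edge_eq⟩

variable [Fintype ι]

theorem PlaneGraph.card_edges_eq (G : PlaneGraph P) (hpt : Function.Injective pt)
    (hP : ∀ p ∈ P, ∃ i, pt i = p) :
    Nat.card {e : OrdPair ι | e.edge pt ∈ G.edges} = G.edges.card := by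
  have : G.edges = (Finset.univ.filter fun e : OrdPair ι => e.edge pt ∈ G.edges).image
      (OrdPair.edge pt) := by
    ext g
    simp only [Finset.mem_image, Finset.mem_filter, Finset.mem_univ, true_and]
    constructor
    · intro hg
      obtain ⟨e, rfl⟩ := G.exists_edge_eq hP hg
      exact ⟨e, hg, rfl⟩
    · rintro ⟨e, he, rfl⟩
      exact he
  conv_rhs => rw [this, Finset.card_image_of_injective _ (OrdPair.edge_injective hpt)]
  rw [← Fintype.card_subtype, ← Nat.card_eq_fintype_card]
  rfl

theorem PlaneGraph.locallyOneSided (G : PlaneGraph P) (hG : PointedGraph G)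
    (hpt : Function.Injective pt) (hP : ∀ i, pt i ∈ P) :
    LocallyOneSided (fun i => complexCoord (pt i)) OrdPair.fst OrdPair.snd
      {e : OrdPair ι | e.edge pt ∈ G.edges} := by
  intro x
  obtain ⟨y, rfl⟩ := complexCoord.surjective x
  by_cases hx : ∃ e : OrdPair ι, e.edge pt ∈ G.edges ∧
    complexCoord y ∈ segment ℝ (complexCoord (pt e.fst)) (complexCoord (pt e.snd))
  swap
  · push Not at hx
    exact ⟨1, one_ne_zero, fun e he h => absurd h (hx e he)⟩
  have hopen : ∀ e : OrdPair ι,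
      complexCoord y ∈ segment ℝ (complexCoord (pt e.fst)) (complexCoord (pt e.snd)) →
      y ≠ pt e.fst → y ≠ pt e.snd → y ∈ oseg (e.edge pt) := by
    intro e he h h'
    rw [OrdPair.edge, oseg_mk, ← complexCoord_mem_openSegment]
    exact mem_openSegment_of_ne_left_right (complexCoord.injective.ne h.symm)
      (complexCoord.injective.ne h'.symm) he
  obtain ⟨e, he, hx⟩ := hx
  by_cases hy : y ∈ P
  · obtain ⟨u, hu⟩ := hG y hy
    have hinner : ∀ e : OrdPair ι, e.edge pt ∈ G.edges →
        complexCoord y ∈ segment ℝ (complexCoord (pt e.fst)) (complexCoord (pt e.snd)) →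
        (y = pt e.fst ∧ 0 < inner ℝ u (pt e.snd - y)) ∨
        (y = pt e.snd ∧ 0 < inner ℝ u (pt e.fst - y)) := by
      intro e he hx
      have hne := hpt.ne e.fst_ne_snd
      by_cases h : y = pt e.fst
      · exact Or.inl ⟨h, hu _ he (by simp [OrdPair.edge, h]) _ (by simp [OrdPair.edge])
          (h ▸ hne.symm)⟩
      by_cases h' : y = pt e.snd
      · exact Or.inr ⟨h', hu _ he (by simp [OrdPair.edge, h']) _ (by simp [OrdPair.edge])
          (h' ▸ hne)⟩
      exact absurd (hopen e hx h h') (G.no_vertex_interior _ he y hy)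
    refine ⟨complexCoord u, ?_, fun e he hx => ?_⟩
    · rw [Ne, map_eq_zero_iff _ complexCoord.injective]
      rintro rfl
      rcases hinner e he hx with ⟨-, h⟩ | ⟨-, h⟩ <;> simp at h
    · rw [← map_sub, ← map_sub, complexCoord.inner_map_map, complexCoord.inner_map_map]
      rcases hinner e he hx with ⟨h, h'⟩ | ⟨h, h'⟩
      · exact ⟨by simp [h], h'.le⟩
      · exact ⟨h'.le, by simp [h]⟩
  · have hyi : ∀ i, y ≠ pt i := fun i h => hy (h ▸ hP i)
    refine ⟨Complex.I * (complexCoord (pt e.snd) - complexCoord (pt e.fst)),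
      mul_ne_zero Complex.I_ne_zero (sub_ne_zero.2
        (complexCoord.injective.ne (hpt.ne e.fst_ne_snd.symm))), fun e' he' hx' => ?_⟩
    have hee : e' = e := by
      by_contra hne
      have := G.noncrossing _ he' _ he ((OrdPair.edge_injective hpt).ne hne)
      exact Set.notMem_empty y (this ▸ ⟨hopen e' hx' (hyi _) (hyi _), hopen e hx (hyi _) (hyi _)⟩)
    subst hee
    rw [inner_I_mul, inner_I_mul, cross_sub_eq_of_mem_segment hx, cross_sub_eq_of_mem_segment hx]
    constructor <;> apply le_of_eq <;> rw [cross_def] <;> simp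
    ring

/-- The graph of the tight bars of an expansive motion. -/
noncomputable def tightGraph {f : OrdPair ι → ℝ} {v : ι → ℂ}
    (hf : IsNegativeLoad (fun i => complexCoord (pt i)) OrdPair.fst OrdPair.snd f)
    (hv : ∀ e, f e ≤ rigidityMap (fun i => complexCoord (pt i)) OrdPair.fst OrdPair.snd v e)
    (hpt : Function.Injective pt) (hz : NoThreeCollinear fun i => complexCoord (pt i))
    (hP : ∀ p, p ∈ P ↔ ∃ i, pt i = p) : PlaneGraph P where
  edges := (Finset.univ.filter fun e =>
    rigidityMap (fun i => complexCoord (pt i)) OrdPair.fst OrdPair.snd v e = f e).image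
      (OrdPair.edge pt)
  not_isDiag g hg := by
    obtain ⟨e, -, rfl⟩ := Finset.mem_image.1 hg
    exact hpt.ne e.fst_ne_snd
  endpoints_mem g hg p hp := by
    obtain ⟨e, -, rfl⟩ := Finset.mem_image.1 hg
    rw [hP]
    rcases Sym2.mem_iff.1 hp with rfl | rfl
    · exact ⟨_, rfl⟩
    · exact ⟨_, rfl⟩
  noncrossing g hg g' hg' hne := by
    obtain ⟨e, he, rfl⟩ := Finset.mem_image.1 hg
    obtain ⟨e', he', rfl⟩ := Finset.mem_image.1 hg'
    rw [Set.eq_empty_iff_forall_notMem]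
    rintro x ⟨hx, hx'⟩
    exact disjoint_openSegment_of_tight hf hv (complexCoord.injective.comp hpt) hz
      (fun h => hne (congrArg _ h)) (Finset.mem_filter.1 he).2 (Finset.mem_filter.1 he').2
      (complexCoord_mem_openSegment.2 hx) (complexCoord_mem_openSegment.2 hx')
  no_vertex_interior g hg p hp := by
    obtain ⟨e, -, rfl⟩ := Finset.mem_image.1 hg
    obtain ⟨k, rfl⟩ := (hP p).1 hp
    exact fun h => hz.notMem_openSegment (complexCoord.injective.comp hpt) e.fst_ne_snd k
      (complexCoord_mem_openSegment.2 h)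

theorem mem_tightGraph_edges {f : OrdPair ι → ℝ} {v : ι → ℂ}
    (hf : IsNegativeLoad (fun i => complexCoord (pt i)) OrdPair.fst OrdPair.snd f)
    (hv : ∀ e, f e ≤ rigidityMap (fun i => complexCoord (pt i)) OrdPair.fst OrdPair.snd v e)
    (hpt : Function.Injective pt) (hz : NoThreeCollinear fun i => complexCoord (pt i))
    (hP : ∀ p, p ∈ P ↔ ∃ i, pt i = p) {e : OrdPair ι} :
    e.edge pt ∈ (tightGraph hf hv hpt hz hP).edges ↔
      rigidityMap (fun i => complexCoord (pt i)) OrdPair.fst OrdPair.snd v e = f e := by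
  simp only [tightGraph]
  rw [(OrdPair.edge_injective hpt).mem_finset_image]
  simp

theorem pointedGraph_tightGraph {f : OrdPair ι → ℝ} {v : ι → ℂ}
    (hf : IsNegativeLoad (fun i => complexCoord (pt i)) OrdPair.fst OrdPair.snd f)
    (hv : ∀ e, f e ≤ rigidityMap (fun i => complexCoord (pt i)) OrdPair.fst OrdPair.snd v e)
    (hpt : Function.Injective pt) (hz : NoThreeCollinear fun i => complexCoord (pt i))
    (hP : ∀ p, p ∈ P ↔ ∃ i, pt i = p) : PointedGraph (tightGraph hf hv hpt hz hP) := by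
  intro p hp
  obtain ⟨i, rfl⟩ := (hP p).1 hp
  obtain ⟨u, hu⟩ := exists_forall_tight_inner_pos hf hv (complexCoord.injective.comp hpt) hz i
  refine ⟨complexCoord.symm u, fun g hg hpg w hw hne => ?_⟩
  obtain ⟨e, rfl⟩ := PlaneGraph.exists_edge_eq _ (fun p hp => (hP p).1 hp) hg
  rw [mem_tightGraph_edges] at hg
  obtain ⟨j, rfl⟩ : ∃ j, pt j = w := by
    rcases Sym2.mem_iff.1 hw with rfl | rfl
    · exact ⟨_, rfl⟩
    · exact ⟨_, rfl⟩
  have := hu e j hg (OrdPair.joins_of_edge_eq hpt ((Sym2.mem_and_mem_iff hne.symm).1 ⟨hpg, hw⟩))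
  rwa [← map_sub, ← complexCoord.symm.inner_map_map, LinearIsometryEquiv.symm_apply_apply] at this

theorem IsPointedPseudoTriangulation.card_edges_add_three {G : PlaneGraph P}
    (hG : IsPointedPseudoTriangulation G) (hgen : GeneralPosition P)
    (hpt : Function.Injective pt) (hP : ∀ p, p ∈ P ↔ ∃ i, pt i = p) {i j : ι} (hij : i ≠ j) :
    G.edges.card + 3 = 2 * Fintype.card ι := by
  have hmem : ∀ i, pt i ∈ P := fun i => (hP _).2 ⟨i, rfl⟩
  have hP' : ∀ p ∈ P, ∃ i, pt i = p := fun p hp => (hP p).1 hp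
  have hinj : Function.Injective fun i => complexCoord (pt i) := complexCoord.injective.comp hpt
  have hz := hgen.noThreeCollinear hpt hmem
  obtain ⟨f, hf⟩ := exists_isNegativeLoad_ordPair hinj hz
  have hF := G.locallyOneSided hG.1 hpt hmem
  have hcard := card_add_finrank_ker hf hF
  rw [G.card_edges_eq hpt hP'] at hcard
  have hge := three_le_finrank_ker_rigidityMapOn (z := fun i => complexCoord (pt i))
    (hinj.ne hij) {e : OrdPair ι | e.edge pt ∈ G.edges}
  rcases hge.eq_or_lt with h3 | h3
  · omega
  obtain ⟨w, hw, hw0⟩ := exists_nontrivial_motion hinj hz hij h3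
  obtain ⟨v, hvF, hv, e, heF, he⟩ := exists_expansive_motion_with_new_tight_bar hf hF hw hw0
  refine absurd ?_ heF
  have hmax := hG.2 (tightGraph hf hv hpt hz hP) (pointedGraph_tightGraph hf hv hpt hz hP) ?_
  · change e.edge pt ∈ G.edges
    rwa [← hmax, mem_tightGraph_edges]
  · intro g hg
    obtain ⟨e', rfl⟩ := G.exists_edge_eq hP' hg
    rw [mem_tightGraph_edges]
    exact hvF e' hg

end Labelling

/-- A pointed pseudo-triangulation of a set of `n` points in
general position in the plane has exactly `2n - 3` edges. -/
theorem pointed_pseudo_triangulation_card_edges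
    (P : Finset Pt) (n : ℕ) (hn : P.card = n) (hgen : GeneralPosition P)
    (G : PlaneGraph P) (hG : IsPointedPseudoTriangulation G) :
    G.edges.card = 2 * n - 3 := by
  rcases le_or_gt P.card 1 with h | h
  · rw [G.edges_eq_empty h, Finset.card_empty]
    omega
  have := hG.card_edges_add_three (pt := fun i => (P.equivFin.symm i : Pt)) hgen
    (Subtype.val_injective.comp P.equivFin.symm.injective)
    (fun p => ⟨fun hp => ⟨P.equivFin ⟨p, hp⟩, by simp⟩, by rintro ⟨i, rfl⟩; simp⟩)
    (i := ⟨0, by omega⟩) (j := ⟨1, h⟩) (by simp)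
  rw [Fintype.card_fin] at this
  omega
end

section
/- In the flip graph of edge-labelled triangulations of a convex polygon with n vertices, interpreted as pointed pseudo-triangulations with exchanging flips, there exist pairs of edge-labelled pointed pseudo-triangulations whose flip distance is Ω(n log n). -/
open scoped Classical

/-- `x` lies strictly inside the (clockwise) arc from `a` to `b` of the convex `n`-gon
with vertices cyclically labelled by `Fin n`. -/
def ArcMem {n : ℕ} (a b x : Fin n) : Prop :=
  0 < (x - a).val ∧ (x - a).val < (b - a).val

/-- Two chords of the convex `n`-gon cross (their interiors intersect). -/
def Crossing {n : ℕ} (e f : Sym2 (Fin n)) : Prop :=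
  ∃ a b c d : Fin n, e = s(a, b) ∧ f = s(c, d) ∧ ArcMem a b c ∧ ArcMem b a d

/-- `e` is a diagonal of the convex `n`-gon: a chord joining two distinct,
non-adjacent vertices. -/
def IsPolygonDiagonal {n : ℕ} [NeZero n] (e : Sym2 (Fin n)) : Prop :=
  ∃ a b : Fin n, e = s(a, b) ∧ a ≠ b ∧ b ≠ a + 1 ∧ a ≠ b + 1

/-- An edge-labelled triangulation of a convex `n`-gon: a maximal set of `n - 3`
pairwise non-crossing diagonals, each carrying a distinct label from `{1, …, n - 3}`. -/
structure LabelledTriangulation (n : ℕ) [NeZero n] where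
  diags : Finset (Sym2 (Fin n))
  isDiag : ∀ e ∈ diags, IsPolygonDiagonal e
  noncrossing : ∀ e ∈ diags, ∀ f ∈ diags, e ≠ f → ¬ Crossing e f
  card_diags : diags.card = n - 3
  label : Sym2 (Fin n) → ℕ
  label_inj : Set.InjOn label (diags : Set (Sym2 (Fin n)))
  label_range : ∀ e ∈ diags, label e ∈ Finset.Icc 1 (n - 3)

/-- A flip in an edge-labelled triangulation of a convex polygon: one diagonal is
replaced by the unique other diagonal of the quadrilateral left by its removal, the new
diagonal inheriting the removed diagonal's label; all other diagonals keep their labels. -/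
def Flip {n : ℕ} [NeZero n] (T T' : LabelledTriangulation n) : Prop :=
  ∃ e e' : Sym2 (Fin n), e ∈ T.diags ∧ e' ∉ T.diags ∧
    T'.diags = insert e' (T.diags.erase e) ∧
    T'.label e' = T.label e ∧
    ∀ f ∈ T.diags.erase e, T'.label f = T.label f


theorem Fin.val_sub_eq_ite {n : ℕ} (x a : Fin n) :
    (x - a).val = if a.val ≤ x.val then x.val - a.val else n + x.val - a.val := by
  split_ifs with h
  · exact Fin.sub_val_of_le h
  · exact Fin.coe_sub_iff_lt.2 (by simpa using h)

theorem arcMem_iff {n : ℕ} (a b x : Fin n) :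
    ArcMem a b x ↔ (a.val < x.val ∧ x.val < b.val) ∨ (x.val < b.val ∧ b.val < a.val) ∨
      (b.val < a.val ∧ a.val < x.val) := by
  have := a.isLt
  have := b.isLt
  have := x.isLt
  unfold ArcMem
  rw [Fin.val_sub_eq_ite, Fin.val_sub_eq_ite]
  split_ifs <;> omega

theorem crossing_mk_iff {n : ℕ} {i j k l : Fin n} (hij : i < j) (hkl : k < l) :
    Crossing s(i, j) s(k, l) ↔
      (i.val < k.val ∧ k.val < j.val ∧ j.val < l.val) ∨
      (k.val < i.val ∧ i.val < l.val ∧ l.val < j.val) := by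
  have hij' : i.val < j.val := hij
  have hkl' : k.val < l.val := hkl
  constructor
  · rintro ⟨a, b, c, d, h₁, h₂, h₃, h₄⟩
    rw [arcMem_iff] at h₃ h₄
    rw [Sym2.eq_iff] at h₁ h₂
    rcases h₁ with ⟨rfl, rfl⟩ | ⟨rfl, rfl⟩ <;> rcases h₂ with ⟨rfl, rfl⟩ | ⟨rfl, rfl⟩ <;> omega
  · rintro (h | h)
    · exact ⟨i, j, k, l, rfl, rfl, by rw [arcMem_iff]; omega, by rw [arcMem_iff]; omega⟩
    · exact ⟨i, j, l, k, rfl, Sym2.eq_swap, by rw [arcMem_iff]; omega, by rw [arcMem_iff]; omega⟩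

theorem Crossing.exists_lt {n : ℕ} {e f : Sym2 (Fin n)} (h : Crossing e f) :
    ∃ i j k l : Fin n, i < j ∧ k < l ∧ e = s(i, j) ∧ f = s(k, l) := by
  obtain ⟨a, b, c, d, rfl, rfl, h₃, h₄⟩ := h
  rw [arcMem_iff] at h₃ h₄
  have hab : a.val < b.val ∨ b.val < a.val := by omega
  have hcd : c.val < d.val ∨ d.val < c.val := by omega
  rcases hab with h | h <;> rcases hcd with h' | h'
  · exact ⟨a, b, c, d, h, h', rfl, rfl⟩
  · exact ⟨a, b, d, c, h, h', rfl, Sym2.eq_swap⟩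
  · exact ⟨b, a, c, d, h, h', Sym2.eq_swap, rfl⟩
  · exact ⟨b, a, d, c, h, h', Sym2.eq_swap, Sym2.eq_swap⟩

theorem Crossing.symm {n : ℕ} {e f : Sym2 (Fin n)} (h : Crossing e f) : Crossing f e := by
  obtain ⟨i, j, k, l, hij, hkl, rfl, rfl⟩ := h.exists_lt
  rw [crossing_mk_iff hkl hij]
  rw [crossing_mk_iff hij hkl] at h
  omega

theorem not_crossing_self {n : ℕ} (e : Sym2 (Fin n)) : ¬ Crossing e e := by
  intro h
  obtain ⟨i, j, k, l, hij, -, rfl, -⟩ := h.exists_lt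
  rw [crossing_mk_iff hij hij] at h
  omega

theorem isPolygonDiagonal_mk_iff {n : ℕ} [NeZero n] (hn : 4 ≤ n) {i j : Fin n} (hij : i < j) :
    IsPolygonDiagonal s(i, j) ↔ i.val + 2 ≤ j.val ∧ ¬ (i.val = 0 ∧ j.val + 1 = n) := by
  have val_succ (a : Fin n) : (a + 1).val = if a.val + 1 = n then 0 else a.val + 1 := by
    have := a.isLt
    rw [Fin.val_add, Fin.val_one', Nat.mod_eq_of_lt (by omega : 1 < n)]
    split_ifs with h
    · rw [h, Nat.mod_self]
    · exact Nat.mod_eq_of_lt (by omega)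
  have hij' : i.val < j.val := hij
  have := j.isLt
  constructor
  · rintro ⟨a, b, h, h₁, h₂, h₃⟩
    rw [Ne, Fin.ext_iff, val_succ] at h₂ h₃
    rw [Sym2.eq_iff] at h
    rcases h with ⟨rfl, rfl⟩ | ⟨rfl, rfl⟩ <;> split_ifs at h₂ h₃ <;> omega
  · intro h
    refine ⟨i, j, rfl, hij.ne, ?_, ?_⟩ <;> rw [Ne, Fin.ext_iff, val_succ] <;> split_ifs <;> omega

theorem IsPolygonDiagonal.exists_lt {n : ℕ} [NeZero n] {e : Sym2 (Fin n)}
    (h : IsPolygonDiagonal e) : ∃ i j : Fin n, i < j ∧ e = s(i, j) := by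
  obtain ⟨a, b, rfl, hab, -, -⟩ := h
  rcases lt_or_gt_of_ne hab with h | h
  · exact ⟨a, b, h, rfl⟩
  · exact ⟨b, a, h, Sym2.eq_swap⟩

theorem Crossing.isPolygonDiagonal_right {n : ℕ} [NeZero n] (hn : 4 ≤ n) {e f : Sym2 (Fin n)}
    (h : Crossing e f) : IsPolygonDiagonal f := by
  obtain ⟨i, j, k, l, hij, hkl, rfl, rfl⟩ := h.exists_lt
  rw [isPolygonDiagonal_mk_iff hn hkl]
  rw [crossing_mk_iff hij hkl] at h
  have := j.isLt
  omega

/-- A family of pairwise non-crossing arcs over `{0, …, N}`, none of them joining consecutive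
points, has at most `N - 1` members: sending `(i, j)` to the largest `k < j` with `k = i + 1` or
`(i, k)` in the family is injective. -/
theorem card_noncrossing_arcs_le {N : ℕ} (D : Finset (ℕ × ℕ))
    (hD : ∀ p ∈ D, p.1 + 2 ≤ p.2 ∧ p.2 ≤ N)
    (hnc : ∀ p ∈ D, ∀ q ∈ D, ¬ (p.1 < q.1 ∧ q.1 < p.2 ∧ p.2 < q.2)) :
    D.card ≤ N - 1 := by
  have apex (p : ℕ × ℕ) (hp : p ∈ D) : ∃ k, (p.1 < k ∧ k < p.2) ∧ (k = p.1 + 1 ∨ (p.1, k) ∈ D) ∧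
      ∀ m, k < m → m < p.2 → (p.1, m) ∉ D := by
    have hp' := hD p hp
    obtain ⟨k, hk, hmax⟩ := Finset.exists_max_image
      ((Finset.Ioo p.1 p.2).filter fun k => k = p.1 + 1 ∨ (p.1, k) ∈ D) id
      ⟨p.1 + 1, by simp; omega⟩
    rw [Finset.mem_filter, Finset.mem_Ioo] at hk
    refine ⟨k, hk.1, hk.2, fun m hkm hm hmD => ?_⟩
    have := hmax m (by simp [hmD]; omega)
    simp only [id] at this
    omega
  choose! φ hφ using apex
  have hcard := Finset.card_le_card_of_injOn (s := D) (t := Finset.Ioo 0 N) φ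
    (fun p hp => by
      have := hφ p hp
      have := hD p hp
      simp only [Finset.coe_Ioo, Set.mem_Ioo]
      omega)
    (by
      have key (p : ℕ × ℕ) (hp : p ∈ D) (q : ℕ × ℕ) (hq : q ∈ D) (h : φ p = φ q) :
          ¬ p.1 < q.1 := by
        intro hlt
        obtain ⟨h₁, h₂, -⟩ := hφ p hp
        obtain ⟨h₃, -, -⟩ := hφ q hq
        rcases h₂ with h₂ | h₂
        · omega
        · exact hnc _ h₂ _ hq ⟨hlt, by simp only; omega, by simp only; omega⟩
      have key' (p : ℕ × ℕ) (hp : p ∈ D) (q : ℕ × ℕ) (hq : q ∈ D) (h : φ p = φ q)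
          (h₁ : p.1 = q.1) : ¬ p.2 < q.2 := by
        intro hlt
        obtain ⟨h₂, -, -⟩ := hφ p hp
        obtain ⟨-, -, h₃⟩ := hφ q hq
        exact h₃ p.2 (by omega) hlt (by rw [← h₁]; exact hp)
      intro p hp q hq h
      have h₁ : p.1 = q.1 := by
        have := key p hp q hq h
        have := key q hq p hp h.symm
        omega
      have := key' p hp q hq h h₁
      have := key' q hq p hp h.symm h₁.symm
      exact Prod.ext h₁ (by omega))
  simpa using hcard

/-- A set of labelled diagonals, pairwise distinct and non-crossing. -/
def NoncrossingDiagonals {n : ℕ} [NeZero n] (X : Finset (Sym2 (Fin n) × ℕ)) : Prop :=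
  (∀ p ∈ X, IsPolygonDiagonal p.1) ∧
    ∀ p ∈ X, ∀ q ∈ X, p ≠ q → p.1 ≠ q.1 ∧ ¬ Crossing p.1 q.1

theorem NoncrossingDiagonals.card_le {n : ℕ} [NeZero n] (hn : 4 ≤ n)
    {X : Finset (Sym2 (Fin n) × ℕ)} (hX : NoncrossingDiagonals X) : X.card ≤ n - 3 := by
  set arc : Sym2 (Fin n) × ℕ → ℕ × ℕ := fun p => (p.1.inf.val, p.1.sup.val) with harc
  have arc_mk (p : Sym2 (Fin n) × ℕ) (hp : p ∈ X) : ∃ i j : Fin n, i < j ∧ p.1 = s(i, j) ∧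
      arc p = (i.val, j.val) ∧ i.val + 2 ≤ j.val ∧ ¬ (i.val = 0 ∧ j.val + 1 = n) := by
    obtain ⟨i, j, hij, h⟩ := (hX.1 p hp).exists_lt
    have hd := hX.1 p hp
    rw [h, isPolygonDiagonal_mk_iff hn hij] at hd
    refine ⟨i, j, hij, h, ?_, hd⟩
    simp only [harc, h, Sym2.inf_mk, Sym2.sup_mk, inf_eq_left.2 hij.le, sup_eq_right.2 hij.le]
  have hinj : Set.InjOn arc X := by
    intro p hp q hq h
    by_contra hne
    apply (hX.2 p hp q hq hne).1
    simp only [harc, Prod.mk.injEq, ← Fin.ext_iff] at h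
    exact Sym2.inf_eq_inf_and_sup_eq_sup.1 h
  have hnotMem : (0, n - 1) ∉ X.image arc := by
    intro h
    obtain ⟨p, hp, h⟩ := Finset.mem_image.1 h
    obtain ⟨i, j, -, -, h', h₁, h₂⟩ := arc_mk p hp
    rw [h', Prod.mk.injEq] at h
    omega
  have := card_noncrossing_arcs_le (N := n - 1) (insert (0, n - 1) (X.image arc))
    (by
      intro p hp
      rcases Finset.mem_insert.1 hp with rfl | hp
      · simp only; omega
      · obtain ⟨q, hq, rfl⟩ := Finset.mem_image.1 hp
        obtain ⟨i, j, -, -, h', h₁, h₂⟩ := arc_mk q hq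
        have := j.isLt
        rw [h']
        simp only; omega)
    (by
      intro p hp q hq
      have bound (p : ℕ × ℕ) (hp : p ∈ X.image arc) : p.2 ≤ n - 1 := by
        obtain ⟨q, hq, rfl⟩ := Finset.mem_image.1 hp
        have := q.1.sup.isLt
        simp only [harc]; omega
      rcases Finset.mem_insert.1 hp with rfl | hp
      · rcases Finset.mem_insert.1 hq with rfl | hq
        · simp only; omega
        · have := bound q hq
          simp only; omega
      · rcases Finset.mem_insert.1 hq with rfl | hq
        · simp only; omega
        · obtain ⟨u, hu, rfl⟩ := Finset.mem_image.1 hp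
          obtain ⟨v, hv, rfl⟩ := Finset.mem_image.1 hq
          obtain ⟨i, j, hij, h₁, h₂, -⟩ := arc_mk u hu
          obtain ⟨k, l, hkl, h₃, h₄, -⟩ := arc_mk v hv
          rw [h₂, h₄]
          intro h
          refine (hX.2 u hu v hv ?_).2 ?_
          · rintro rfl
            simp only at h
            rw [h₂, Prod.mk.injEq] at h₄
            omega
          · rw [h₁, h₃, crossing_mk_iff hij hkl]
            exact Or.inl h)
  rw [Finset.card_insert_of_notMem hnotMem, Finset.card_image_of_injOn hinj] at this
  omega

theorem NoncrossingDiagonals.exists_eq_or_crossing {n : ℕ} [NeZero n] (hn : 4 ≤ n)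
    {X : Finset (Sym2 (Fin n) × ℕ)} (hX : NoncrossingDiagonals X) (hcard : X.card = n - 3)
    {f : Sym2 (Fin n)} (hf : IsPolygonDiagonal f) :
    ∃ p ∈ X, p.1 = f ∨ Crossing p.1 f := by
  by_contra! h
  have hnotMem : (f, 0) ∉ X := fun hm => (h _ hm).1 rfl
  have := NoncrossingDiagonals.card_le hn (X := insert (f, 0) X) (by
    constructor
    · intro p hp
      rcases Finset.mem_insert.1 hp with rfl | hp
      · exact hf
      · exact hX.1 p hp
    · intro p hp q hq hne
      rcases Finset.mem_insert.1 hp with rfl | hp <;> rcases Finset.mem_insert.1 hq with rfl | hq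
      · exact absurd rfl hne
      · exact ⟨fun h' => (h q hq).1 h'.symm, fun h' => (h q hq).2 h'.symm⟩
      · exact h p hp
      · exact hX.2 p hp q hq hne)
  rw [Finset.card_insert_of_notMem hnotMem] at this
  omega

theorem Crossing.exists_cyclic {n : ℕ} {e f : Sym2 (Fin n)} (h : Crossing e f) :
    ∃ a c b d : Fin n, a < c ∧ c < b ∧ b < d ∧
      ((e = s(a, b) ∧ f = s(c, d)) ∨ (e = s(c, d) ∧ f = s(a, b))) := by
  obtain ⟨i, j, k, l, hij, hkl, rfl, rfl⟩ := h.exists_lt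
  rw [crossing_mk_iff hij hkl] at h
  rcases h with ⟨h₁, h₂, h₃⟩ | ⟨h₁, h₂, h₃⟩
  · exact ⟨i, k, j, l, h₁, h₂, h₃, Or.inl ⟨rfl, rfl⟩⟩
  · exact ⟨k, i, l, j, h₁, h₂, h₃, Or.inr ⟨rfl, rfl⟩⟩

/-- Two crossing chords `e`, `e'` span a quadrilateral with at most four sides: a chord avoiding
both `e` and `e'` avoids the sides, which do not cross `e'` either, while every chord that crosses
`e` and differs from `e'` crosses one of the sides. -/
theorem Crossing.exists_sides {n : ℕ} {e e' : Sym2 (Fin n)} (h : Crossing e e') :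
    ∃ S : Finset (Sym2 (Fin n)), S.card ≤ 4 ∧
      (∀ s ∈ S, s ≠ e' ∧ ¬ Crossing e' s) ∧
      (∀ f, ¬ Crossing f e → ¬ Crossing f e' → ∀ s ∈ S, ¬ Crossing f s) ∧
      ∀ f, Crossing f e → f ≠ e' → ∃ s ∈ S, Crossing f s := by
  obtain ⟨a, c, b, d, hac, hcb, hbd, h⟩ := h.exists_cyclic
  have had : a < d := hac.trans (hcb.trans hbd)
  have hab : a < b := hac.trans hcb
  have hcd : c < d := hcb.trans hbd
  have mem_sides {P : Sym2 (Fin n) → Prop} :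
      (∀ s ∈ ({s(a, c), s(c, b), s(b, d), s(a, d)} : Finset (Sym2 (Fin n))), P s) ↔
        P s(a, c) ∧ P s(c, b) ∧ P s(b, d) ∧ P s(a, d) := by
    simp
  refine ⟨{s(a, c), s(c, b), s(b, d), s(a, d)}, Finset.card_le_four, ?_, ?_, ?_⟩
  · rw [mem_sides]
    rcases h with ⟨rfl, rfl⟩ | ⟨rfl, rfl⟩ <;>
      simp only [Ne, crossing_mk_iff hab, crossing_mk_iff hcd, hac, hcb, hbd, had, Sym2.eq_iff,
        Fin.ext_iff] <;>
      rw [Fin.lt_def] at * <;> omega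
  · intro f hfe hfe'
    have hfab : ¬ Crossing f s(a, b) := by rcases h with ⟨rfl, rfl⟩ | ⟨rfl, rfl⟩ <;> assumption
    have hfcd : ¬ Crossing f s(c, d) := by rcases h with ⟨rfl, rfl⟩ | ⟨rfl, rfl⟩ <;> assumption
    intro s hs hfs
    obtain ⟨i, j, -, -, hij, -, rfl, -⟩ := hfs.exists_lt
    revert s
    rw [mem_sides]
    rw [crossing_mk_iff hij hab] at hfab
    rw [crossing_mk_iff hij hcd] at hfcd
    simp only [crossing_mk_iff hij hac, crossing_mk_iff hij hcb, crossing_mk_iff hij hbd,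
      crossing_mk_iff hij had]
    rw [Fin.lt_def] at *
    omega
  · intro f hfe hfe'
    obtain ⟨i, j, -, -, hij, -, rfl, -⟩ := hfe.exists_lt
    by_contra! hcon
    rw [mem_sides] at hcon
    simp only [crossing_mk_iff hij hac, crossing_mk_iff hij hcb, crossing_mk_iff hij hbd,
      crossing_mk_iff hij had] at hcon
    rcases h with ⟨rfl, rfl⟩ | ⟨rfl, rfl⟩
    · rw [crossing_mk_iff hij hab] at hfe
      rw [Ne, Sym2.eq_iff, Fin.ext_iff, Fin.ext_iff, Fin.ext_iff, Fin.ext_iff] at hfe'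
      rw [Fin.lt_def] at *
      omega
    · rw [crossing_mk_iff hij hcd] at hfe
      rw [Ne, Sym2.eq_iff, Fin.ext_iff, Fin.ext_iff, Fin.ext_iff, Fin.ext_iff] at hfe'
      rw [Fin.lt_def] at *
      omega

/-- A flip of the labelled diagonal `p`, on triangulations viewed as sets of labelled diagonals. -/
def FlipAt {n : ℕ} [NeZero n] (p : Sym2 (Fin n) × ℕ) (X Y : Finset (Sym2 (Fin n) × ℕ)) : Prop :=
  p ∈ X ∧ NoncrossingDiagonals X ∧ X.card = n - 3 ∧ ∃ e', Crossing p.1 e' ∧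
    (∀ q ∈ X.erase p, q.1 ≠ e' ∧ ¬ Crossing q.1 e') ∧ Y = insert (e', p.2) (X.erase p)

theorem NoncrossingDiagonals.insert_erase {n : ℕ} [NeZero n]
    {X : Finset (Sym2 (Fin n) × ℕ)} (hX : NoncrossingDiagonals X) {p : Sym2 (Fin n) × ℕ}
    (hp : p ∈ X) {e' : Sym2 (Fin n)} (he' : IsPolygonDiagonal e')
    (h : ∀ q ∈ X.erase p, q.1 ≠ e' ∧ ¬ Crossing q.1 e') (k : ℕ) :
    NoncrossingDiagonals (insert (e', k) (X.erase p)) ∧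
      (insert (e', k) (X.erase p)).card = X.card := by
  refine ⟨⟨?_, ?_⟩, ?_⟩
  · intro q hq
    rcases Finset.mem_insert.1 hq with rfl | hq
    · exact he'
    · exact hX.1 q (Finset.mem_of_mem_erase hq)
  · intro q hq r hr hne
    rcases Finset.mem_insert.1 hq with rfl | hq <;> rcases Finset.mem_insert.1 hr with rfl | hr
    · exact absurd rfl hne
    · exact ⟨(h r hr).1.symm, fun h' => (h r hr).2 h'.symm⟩
    · exact h q hq
    · exact hX.2 q (Finset.mem_of_mem_erase hq) r (Finset.mem_of_mem_erase hr) hne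
  · rw [Finset.card_insert_of_notMem fun h' => (h _ h').1 rfl, Finset.card_erase_add_one hp]

/-- The sides of the quadrilateral of a flip that are diagonals belong to the triangulation. -/
theorem NoncrossingDiagonals.exists_sides {n : ℕ} [NeZero n] (hn : 4 ≤ n) {p : Sym2 (Fin n) × ℕ}
    {X : Finset (Sym2 (Fin n) × ℕ)} (hX : NoncrossingDiagonals X) (hp : p ∈ X)
    (hcard : X.card = n - 3) {e' : Sym2 (Fin n)} (hc : Crossing p.1 e')
    (h : ∀ q ∈ X.erase p, q.1 ≠ e' ∧ ¬ Crossing q.1 e') :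
    ∃ S ⊆ X.erase p, S.card ≤ 4 ∧
      ∀ f, Crossing f p.1 → f ≠ e' → ∃ s ∈ S, Crossing f s.1 := by
  obtain ⟨S, hS, hS₁, hS₂, hS₃⟩ := hc.exists_sides
  obtain ⟨hY, hYcard⟩ := hX.insert_erase hp (hc.isPolygonDiagonal_right hn) h p.2
  refine ⟨(X.erase p).filter fun q => q.1 ∈ S, Finset.filter_subset _ _, ?_, ?_⟩
  · refine (Finset.card_le_card_of_injOn Prod.fst (fun q hq => (Finset.mem_filter.1 hq).2) ?_).trans
      hS
    intro q hq r hr hqr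
    by_contra hne
    exact (hX.2 q (Finset.mem_of_mem_erase (Finset.mem_filter.1 hq).1) r
      (Finset.mem_of_mem_erase (Finset.mem_filter.1 hr).1) hne).1 hqr
  · intro f hf hne
    obtain ⟨s, hs, hfs⟩ := hS₃ f hf hne
    obtain ⟨q, hq, hqs⟩ := hY.exists_eq_or_crossing hn (hYcard.trans hcard)
      (hfs.isPolygonDiagonal_right hn)
    rcases Finset.mem_insert.1 hq with rfl | hq
    · rcases hqs with rfl | hqs
      · exact absurd rfl (hS₁ _ hs).1
      · exact absurd hqs (hS₁ _ hs).2
    · rcases hqs with rfl | hqs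
      · exact ⟨q, Finset.mem_filter.2 ⟨hq, hs⟩, hfs⟩
      · exact absurd hqs (hS₂ q.1 (hX.2 q (Finset.mem_of_mem_erase hq) p hp
          (Finset.ne_of_mem_erase hq)).2 (h q hq).2 s hs)

theorem FlipAt.unique {n : ℕ} [NeZero n] (hn : 4 ≤ n) {p : Sym2 (Fin n) × ℕ}
    {X Y Z : Finset (Sym2 (Fin n) × ℕ)} (hY : FlipAt p X Y) (hZ : FlipAt p X Z) : Y = Z := by
  obtain ⟨hp, hX, hcard, e, hc, he, rfl⟩ := hY
  obtain ⟨-, -, -, f, hc', hf, rfl⟩ := hZ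
  by_cases hef : f = e
  · rw [hef]
  · obtain ⟨S, hS, -, hS'⟩ := hX.exists_sides hn hp hcard hc he
    obtain ⟨s, hs, hfs⟩ := hS' f hc'.symm hef
    exact absurd hfs.symm (hf s (hS hs)).2

/-- A flip following the flip of `p` can be performed first, unless it flips the diagonal that
replaced `p` or one of the at most four sides of the surrounding quadrilateral. -/
theorem FlipAt.exists_swap {n : ℕ} [NeZero n] (hn : 4 ≤ n) {p : Sym2 (Fin n) × ℕ}
    {X Y : Finset (Sym2 (Fin n) × ℕ)} (hY : FlipAt p X Y) :
    ∃ A : Finset (Sym2 (Fin n) × ℕ), A.card ≤ 5 ∧ ∀ q Z, FlipAt q Y Z → q ∉ A →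
      q ≠ p ∧ ∃ W, FlipAt q X W ∧ FlipAt p W Z := by
  obtain ⟨hp, hX, hcard, e, hc, he, rfl⟩ := hY
  obtain ⟨S, hS, hS₄, hS'⟩ := hX.exists_sides hn hp hcard hc he
  refine ⟨insert (e, p.2) S, (Finset.card_insert_le _ _).trans (by omega), ?_⟩
  rintro q Z ⟨hq, hY, -, f, hqf, hf, rfl⟩ hqA
  rw [Finset.mem_insert, not_or] at hqA
  have hqX : q ∈ X.erase p := Finset.mem_of_mem_insert_of_ne hq hqA.1
  have hqp : q ≠ p := Finset.ne_of_mem_erase hqX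
  have hef := hf (e, p.2) (Finset.mem_erase.2 ⟨Ne.symm hqA.1, Finset.mem_insert_self _ _⟩)
  have hpf : p.1 ≠ f ∧ ¬ Crossing p.1 f := by
    constructor
    · rintro rfl
      exact hef.2 hc.symm
    · intro hpf
      obtain ⟨s, hs, hfs⟩ := hS' f hpf.symm hef.1.symm
      refine (hf s (Finset.mem_erase.2 ⟨?_, Finset.mem_insert_of_mem (hS hs)⟩)).2 hfs.symm
      rintro rfl
      exact hqA.2 hs
  have hfX : ∀ r ∈ X.erase q, r.1 ≠ f ∧ ¬ Crossing r.1 f := by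
    intro r hr
    by_cases hrp : r = p
    · rw [hrp]
      exact hpf
    · rw [Finset.mem_erase] at hr
      exact hf r (Finset.mem_erase.2 ⟨hr.1,
        Finset.mem_insert_of_mem (Finset.mem_erase.2 ⟨hrp, hr.2⟩)⟩)
  have hqX' := Finset.mem_of_mem_erase hqX
  obtain ⟨hW, hWcard⟩ := hX.insert_erase hqX' (hqf.isPolygonDiagonal_right hn) hfX q.2
  refine ⟨hqp, insert (f, q.2) (X.erase q), ⟨hqX', hX, hcard, f, hqf, hfX, rfl⟩, ?_, hW,
    hWcard.trans hcard, e, hc, ?_, ?_⟩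
  · exact Finset.mem_insert_of_mem (Finset.mem_erase.2 ⟨hqp.symm, hp⟩)
  · intro r hr
    rw [Finset.mem_erase, Finset.mem_insert, Finset.mem_erase] at hr
    rcases hr with ⟨hrp, rfl | hr⟩
    · exact ⟨hef.1.symm, fun h => hef.2 h.symm⟩
    · exact he r (Finset.mem_erase.2 ⟨hrp, hr.2⟩)
  · have hfp : (f, q.2) ≠ p := fun h => hpf.1 (by rw [← h])
    rw [Finset.erase_insert_of_ne (Ne.symm hqA.1), Finset.erase_insert_of_ne hfp,
      Finset.insert_comm, Finset.erase_right_comm]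

/-- `Z` can be reached from `X` by exactly `k` moves, where `step p` is the move at `p`. -/
def ReachableIn {α σ : Type*} (step : α → σ → σ → Prop) : ℕ → σ → σ → Prop
  | 0, X, Z => X = Z
  | k + 1, X, Z => ∃ p Y, step p X Y ∧ ReachableIn step k Y Z

/-- Suppose moves are deterministic and a move following the move at `p` can be interchanged with
it unless it takes place in a set of at most `d` positions. If all possible first moves of a
`k`-move sequence from `X` to `Z` lie in `L`, then `Z` is one of at most `2 ^ (#L + d * k)` states:
go through the elements of `L`, recording for each whether a move is made there, and add the `d`
affected positions to `L` after each move. -/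
theorem exists_finset_reachableIn {α σ : Type*} [DecidableEq α] [DecidableEq σ]
    {step : α → σ → σ → Prop} {d : ℕ}
    (hdet : ∀ p X Y Z, step p X Y → step p X Z → Y = Z)
    (hswap : ∀ p X Y, step p X Y → ∃ A : Finset α, A.card ≤ d ∧
      ∀ q Z, step q Y Z → q ∉ A → q ≠ p ∧ ∃ W, step q X W ∧ step p W Z)
    (M : ℕ) (X : σ) (L : Finset α) (k : ℕ) (hM : L.card + d * k ≤ M) :
    ∃ F : Finset σ, F.card ≤ 2 ^ M ∧ ∀ Z, ReachableIn step k X Z →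
      (∀ p Y j, k = j + 1 → step p X Y → ReachableIn step j Y Z → p ∈ L) → Z ∈ F := by
  induction M generalizing X L k with
  | zero =>
    refine ⟨{X}, by simp, fun Z hZ hL => ?_⟩
    cases k with
    | zero => exact Finset.mem_singleton.2 hZ.symm
    | succ k =>
      obtain ⟨p, Y, hY, hZ⟩ := hZ
      have := Finset.card_pos.2 ⟨p, hL p Y k rfl hY hZ⟩
      omega
  | succ M ih =>
    cases k with
    | zero =>
      exact ⟨{X}, by simp [Nat.one_le_two_pow], fun Z hZ _ => Finset.mem_singleton.2 hZ.symm⟩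
    | succ k =>
      rcases L.eq_empty_or_nonempty with rfl | ⟨p, hp⟩
      · refine ⟨∅, by simp, fun Z ⟨p, Y, hY, hZ⟩ hL => ?_⟩
        exact absurd (hL p Y k rfl hY hZ) (Finset.notMem_empty p)
      have hcard := Finset.card_erase_add_one hp
      rw [Nat.mul_succ] at hM
      obtain ⟨F, hF, hF'⟩ := ih X (L.erase p) (k + 1) (by rw [Nat.mul_succ]; omega)
      have hmove : ∃ G : Finset σ, G.card ≤ 2 ^ M ∧ ∀ Z Y, step p X Y → ReachableIn step k Y Z →
          (∀ q Y j, k + 1 = j + 1 → step q X Y → ReachableIn step j Y Z → q ∈ L) → Z ∈ G := by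
        by_cases hex : ∃ Y, step p X Y
        · obtain ⟨Y, hY⟩ := hex
          obtain ⟨A, hA, hA'⟩ := hswap p X Y hY
          obtain ⟨G, hG, hG'⟩ := ih Y (A ∪ L.erase p) k (by
            have := Finset.card_union_le A (L.erase p)
            omega)
          refine ⟨G, hG, fun Z Y' hY' hZ hL => ?_⟩
          obtain rfl := hdet p X Y Y' hY hY'
          refine hG' Z hZ fun q V j hj hV hVZ => ?_
          by_contra hq
          rw [Finset.mem_union, not_or] at hq
          obtain ⟨hqp, W, hW, hWV⟩ := hA' q V hV hq.1
          refine hq.2 (Finset.mem_erase.2 ⟨hqp, hL q W k rfl hW ?_⟩)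
          rw [hj]
          exact ⟨p, V, hWV, hVZ⟩
        · exact ⟨∅, by simp, fun Z Y hY => absurd ⟨Y, hY⟩ hex⟩
      obtain ⟨G, hG, hG'⟩ := hmove
      refine ⟨F ∪ G, (Finset.card_union_le _ _).trans (by rw [pow_succ]; omega), fun Z hZ hL => ?_⟩
      rw [Finset.mem_union]
      by_cases hpZ : ∃ Y, step p X Y ∧ ReachableIn step k Y Z
      · obtain ⟨Y, hY, hYZ⟩ := hpZ
        exact Or.inr (hG' Z Y hY hYZ hL)
      · refine Or.inl (hF' Z hZ fun q Y j hj hY hYZ => ?_)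
        refine Finset.mem_erase.2 ⟨?_, hL q Y j hj hY hYZ⟩
        rintro rfl
        obtain rfl : k = j := by omega
        exact hpZ ⟨Y, hY, hYZ⟩

namespace LabelledTriangulation

/-- The diagonals of a labelled triangulation, together with their labels. -/
noncomputable def labelledDiags {n : ℕ} [NeZero n] (T : LabelledTriangulation n) :
    Finset (Sym2 (Fin n) × ℕ) :=
  T.diags.image fun e => (e, T.label e)

theorem mem_labelledDiags {n : ℕ} [NeZero n] {T : LabelledTriangulation n}
    {p : Sym2 (Fin n) × ℕ} : p ∈ T.labelledDiags ↔ p.1 ∈ T.diags ∧ T.label p.1 = p.2 := by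
  unfold labelledDiags
  rw [Finset.mem_image]
  constructor
  · rintro ⟨e, he, rfl⟩
    exact ⟨he, rfl⟩
  · rintro ⟨h₁, h₂⟩
    exact ⟨p.1, h₁, by rw [h₂]⟩

theorem card_labelledDiags {n : ℕ} [NeZero n] (T : LabelledTriangulation n) :
    T.labelledDiags.card = n - 3 := by
  rw [← T.card_diags]
  exact Finset.card_image_of_injective _ fun _ _ h => (Prod.ext_iff.1 h).1

theorem noncrossingDiagonals_labelledDiags {n : ℕ} [NeZero n] (T : LabelledTriangulation n) :
    NoncrossingDiagonals T.labelledDiags := by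
  refine ⟨fun p hp => T.isDiag _ (mem_labelledDiags.1 hp).1, fun p hp q hq hne => ?_⟩
  rw [mem_labelledDiags] at hp hq
  have h : p.1 ≠ q.1 := fun h => hne (Prod.ext h (by rw [← hp.2, ← hq.2, h]))
  exact ⟨h, T.noncrossing _ hp.1 _ hq.1 h⟩

end LabelledTriangulation

open LabelledTriangulation in
theorem Flip.exists_flipAt {n : ℕ} [NeZero n] (hn : 4 ≤ n) {T T' : LabelledTriangulation n}
    (h : Flip T T') : ∃ p, FlipAt p T.labelledDiags T'.labelledDiags := by
  obtain ⟨e, e', he, he', hdiags, hlabel, hlabel'⟩ := h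
  have mem' {f : Sym2 (Fin n)} (hf : f ∈ T.diags) (hfe : f ≠ e) : f ∈ T'.diags := by
    rw [hdiags]
    exact Finset.mem_insert_of_mem (Finset.mem_erase.2 ⟨hfe, hf⟩)
  have he'T' : e' ∈ T'.diags := by
    rw [hdiags]
    exact Finset.mem_insert_self _ _
  have hne : ∀ q ∈ T.labelledDiags.erase (e, T.label e), q.1 ∈ T.diags ∧ q.1 ≠ e ∧
      T.label q.1 = q.2 := by
    intro q hq
    rw [Finset.mem_erase, mem_labelledDiags] at hq
    refine ⟨hq.2.1, fun h => hq.1 (Prod.ext h ?_), hq.2.2⟩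
    rw [← hq.2.2, h]
  have hnc : ∀ q ∈ T.labelledDiags.erase (e, T.label e), q.1 ≠ e' ∧ ¬ Crossing q.1 e' := by
    intro q hq
    obtain ⟨h₁, h₂, -⟩ := hne q hq
    have h : q.1 ≠ e' := by
      intro h
      rw [h] at h₁
      exact he' h₁
    exact ⟨h, T'.noncrossing _ (mem' h₁ h₂) _ he'T' h⟩
  refine ⟨(e, T.label e), mem_labelledDiags.2 ⟨he, rfl⟩, T.noncrossingDiagonals_labelledDiags,
    T.card_labelledDiags, e', ?_, hnc, ?_⟩
  · obtain ⟨q, hq, h⟩ := T.noncrossingDiagonals_labelledDiags.exists_eq_or_crossing hn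
      T.card_labelledDiags (T'.isDiag e' he'T')
    have hqe : q = (e, T.label e) := by
      by_contra hqe
      have := hnc q (Finset.mem_erase.2 ⟨hqe, hq⟩)
      exact h.elim this.1 this.2
    rw [hqe] at h
    refine h.resolve_left ?_
    rintro rfl
    exact he' he
  · ext q
    rw [Finset.mem_insert, mem_labelledDiags, hdiags, Finset.mem_insert]
    constructor
    · rintro ⟨h₁ | h₁, h₂⟩
      · refine Or.inl (Prod.ext h₁ ?_)
        rw [← h₂, h₁, hlabel]
      · rw [hlabel' _ h₁] at h₂
        refine Or.inr (Finset.mem_erase.2 ⟨fun h => ?_, mem_labelledDiags.2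
          ⟨Finset.mem_of_mem_erase h₁, h₂⟩⟩)
        exact Finset.ne_of_mem_erase h₁ (by rw [h])
    · rintro (rfl | hq)
      · exact ⟨Or.inl rfl, hlabel⟩
      · obtain ⟨h₁, h₂, h₃⟩ := hne q hq
        have h₄ := Finset.mem_erase.2 ⟨h₂, h₁⟩
        exact ⟨Or.inr h₄, by rw [hlabel' _ h₄, h₃]⟩

theorem reachableIn_labelledDiags {n : ℕ} [NeZero n] (hn : 4 ≤ n)
    (l : List (LabelledTriangulation n)) (T : LabelledTriangulation n)
    (hl : List.IsChain Flip (T :: l)) :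
    ReachableIn FlipAt l.length T.labelledDiags
      ((T :: l).getLast (List.cons_ne_nil _ _)).labelledDiags := by
  induction l generalizing T with
  | nil => rfl
  | cons U l ih =>
    rw [List.isChain_cons_cons] at hl
    obtain ⟨p, hp⟩ := hl.1.exists_flipAt hn
    rw [List.getLast_cons (List.cons_ne_nil _ _)]
    exact ⟨p, _, hp, ih U hl.2⟩

/-- At most `2 ^ (n + 6 * K)` labelled triangulations are reachable by at most `K` flips. -/
theorem exists_finset_labelledDiags {n : ℕ} [NeZero n] (hn : 4 ≤ n)
    (T : LabelledTriangulation n) (K : ℕ) :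
    ∃ F : Finset (Finset (Sym2 (Fin n) × ℕ)), F.card ≤ 2 ^ (n + 6 * K) ∧
      ∀ l : List (LabelledTriangulation n), List.IsChain Flip (T :: l) → l.length ≤ K →
        ((T :: l).getLast (List.cons_ne_nil _ _)).labelledDiags ∈ F := by
  have reach (k : ℕ) := exists_finset_reachableIn (step := FlipAt (n := n)) (d := 5)
    (fun p X Y Z hY hZ => hY.unique hn hZ) (fun p X Y hY => hY.exists_swap hn) (n - 3 + 5 * k)
    T.labelledDiags T.labelledDiags k (by rw [T.card_labelledDiags])
  choose F hF hF' using reach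
  refine ⟨(Finset.range (K + 1)).biUnion F, ?_, fun l hl hlK => ?_⟩
  · calc ((Finset.range (K + 1)).biUnion F).card
        ≤ (Finset.range (K + 1)).card * 2 ^ (n + 5 * K) :=
          Finset.card_biUnion_le_card_mul _ _ _ fun k hk => (hF k).trans
            (Nat.pow_le_pow_right two_pos (by rw [Finset.mem_range] at hk; omega))
      _ ≤ 2 ^ K * 2 ^ (n + 5 * K) := by
          rw [Finset.card_range]
          exact Nat.mul_le_mul_right _ Nat.lt_two_pow_self
      _ = 2 ^ (n + 6 * K) := by
          rw [← pow_add]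
          congr 1
          omega
  · refine Finset.mem_biUnion.2 ⟨l.length, Finset.mem_range.2 (by omega), ?_⟩
    exact hF' _ _ (reachableIn_labelledDiags hn l T hl) fun p Y j _ hp _ => hp.1

/-- The `i`-th diagonal of the fan at the vertex `0`. -/
def fanDiag (n : ℕ) [NeZero n] (i : Fin (n - 3)) : Sym2 (Fin n) :=
  s(0, ⟨i.val + 2, by omega⟩)

theorem fanDiag_injective (n : ℕ) [NeZero n] : Function.Injective (fanDiag n) := by
  intro i j h
  rw [fanDiag, fanDiag, Sym2.congr_right, Fin.mk.injEq] at h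
  exact Fin.ext (by omega)

/-- The fan triangulation at the vertex `0`, labelled according to a permutation. -/
noncomputable def labelledFan {n : ℕ} [NeZero n] (hn : 4 ≤ n) (σ : Equiv.Perm (Fin (n - 3))) :
    LabelledTriangulation n where
  diags := Finset.univ.image (fanDiag n)
  isDiag e he := by
    obtain ⟨i, -, rfl⟩ := Finset.mem_image.1 he
    have h : (0 : Fin n) < ⟨i.val + 2, by omega⟩ := by simp [Fin.lt_def]
    rw [fanDiag, isPolygonDiagonal_mk_iff hn h, Fin.val_zero]
    simp only
    omega
  noncrossing e he f hf _ h := by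
    obtain ⟨i, -, rfl⟩ := Finset.mem_image.1 he
    obtain ⟨j, -, rfl⟩ := Finset.mem_image.1 hf
    rw [fanDiag, fanDiag, crossing_mk_iff (by simp [Fin.lt_def]) (by simp [Fin.lt_def])] at h
    omega
  card_diags := by
    rw [Finset.card_image_of_injective _ (fanDiag_injective n), Finset.card_univ, Fintype.card_fin]
  label := Function.extend (fanDiag n) (fun i => (σ i).val + 1) 0
  label_inj e he f hf h := by
    obtain ⟨i, -, rfl⟩ := Finset.mem_image.1 he
    obtain ⟨j, -, rfl⟩ := Finset.mem_image.1 hf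
    rw [(fanDiag_injective n).extend_apply, (fanDiag_injective n).extend_apply] at h
    rw [σ.injective (Fin.ext (by omega) : σ i = σ j)]
  label_range e he := by
    obtain ⟨i, -, rfl⟩ := Finset.mem_image.1 he
    rw [(fanDiag_injective n).extend_apply, Finset.mem_Icc]
    omega

theorem labelledFan_label_fanDiag {n : ℕ} [NeZero n] (hn : 4 ≤ n) (σ : Equiv.Perm (Fin (n - 3)))
    (i : Fin (n - 3)) : (labelledFan hn σ).label (fanDiag n i) = (σ i).val + 1 :=
  (fanDiag_injective n).extend_apply (fun i => (σ i).val + 1) 0 i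

theorem labelledDiags_labelledFan_injective {n : ℕ} [NeZero n] (hn : 4 ≤ n) :
    Function.Injective fun σ => (labelledFan hn σ).labelledDiags := by
  intro σ τ h
  ext i
  have hi : (fanDiag n i, (σ i).val + 1) ∈ (labelledFan hn σ).labelledDiags :=
    LabelledTriangulation.mem_labelledDiags.2
      ⟨Finset.mem_image_of_mem _ (Finset.mem_univ i), labelledFan_label_fanDiag hn σ i⟩
  simp only at h
  rw [h, LabelledTriangulation.mem_labelledDiags] at hi
  have : (τ i).val + 1 = (σ i).val + 1 :=
    (labelledFan_label_fanDiag hn τ i).symm.trans hi.2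
  omega

/-- If `K` flips suffice between any two labelled triangulations, then the `(n - 3)!` labellings of
a fan are among the at most `2 ^ (n + 6 * K)` labelled triangulations reachable from one of them. -/
theorem factorial_le_of_forall_exists_chain {n : ℕ} [NeZero n] (hn : 4 ≤ n) {K : ℕ}
    (h : ∀ T₁ T₂ : LabelledTriangulation n, ∃ l : List (LabelledTriangulation n),
      List.IsChain Flip (T₁ :: l) ∧ (T₁ :: l).getLast (List.cons_ne_nil _ _) = T₂ ∧
        l.length ≤ K) :
    (n - 3).factorial ≤ 2 ^ (n + 6 * K) := by
  obtain ⟨F, hF, hF'⟩ := exists_finset_labelledDiags hn (labelledFan hn 1) K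
  refine le_trans ?_ hF
  calc (n - 3).factorial = (Finset.univ : Finset (Equiv.Perm (Fin (n - 3)))).card := by
        rw [Finset.card_univ, Fintype.card_perm, Fintype.card_fin]
    _ ≤ F.card := Finset.card_le_card_of_injOn _ (fun σ _ => ?_)
        (labelledDiags_labelledFan_injective hn).injOn
  obtain ⟨l, hl, hlast, hlK⟩ := h (labelledFan hn 1) (labelledFan hn σ)
  have := hF' l hl hlK
  rwa [hlast] at this

theorem two_pow_lt_factorial {n K : ℕ} (hn : 2 ^ 18 ≤ n) (hK : (K : ℝ) ≤ 1 / 100 * n * Real.log n) :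
    2 ^ (n + 6 * K) < (n - 3).factorial := by
  have hn' : (2 : ℝ) ^ 18 ≤ n := by exact_mod_cast hn
  have hn₀ : (0 : ℝ) < n := lt_of_lt_of_le (by norm_num) hn'
  have hlog2 := Real.log_two_gt_d9
  have hlog2' := Real.log_two_lt_d9
  have hlog : 12 ≤ Real.log n := by
    have := Real.log_le_log (by norm_num) hn'
    rw [Real.log_pow] at this
    push_cast at this
    linarith
  set m := n - 3 with hm
  have hm' : (n : ℝ) / 2 ≤ m := by
    have : n ≤ 2 * m := by omega
    have : (n : ℝ) ≤ 2 * m := by exact_mod_cast this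
    linarith
  have hm₀ : (0 : ℝ) < m := by linarith
  have hlogm : Real.log n - Real.log 2 ≤ Real.log m := by
    rw [← Real.log_div hn₀.ne' two_ne_zero]
    exact Real.log_le_log (by linarith) hm'
  have hfact : (m : ℝ) * Real.log m - m ≤ Real.log m.factorial := by
    have h := Stirling.le_log_factorial_stirling (n := m) (by omega)
    have h₁ : 0 ≤ Real.log (2 * Real.pi) := Real.log_nonneg (by linarith [Real.pi_gt_three])
    linarith
  have hlower : (n : ℝ) * Real.log n / 4 ≤ m * Real.log m - m := by
    have h₁ : Real.log n / 2 ≤ Real.log m - 1 := by linarith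
    calc (n : ℝ) * Real.log n / 4 = n / 2 * (Real.log n / 2) := by ring
      _ ≤ m * (Real.log m - 1) := mul_le_mul hm' h₁ (by linarith) hm₀.le
      _ = m * Real.log m - m := by ring
  have hupper : ((n : ℝ) + 6 * K) * Real.log 2 < n * Real.log n / 4 := by
    have h₁ : ((n : ℝ) + 6 * K) * Real.log 2 ≤ ((n : ℝ) + 6 * K) * 1 :=
      mul_le_mul_of_nonneg_left (by linarith) (by positivity)
    have h₂ : (n : ℝ) * 12 ≤ n * Real.log n := mul_le_mul_of_nonneg_left hlog hn₀.le
    linarith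
  have h : Real.log ((2 : ℝ) ^ (n + 6 * K)) < Real.log m.factorial := by
    rw [Real.log_pow]
    push_cast
    linarith
  rw [Real.log_lt_log_iff (by positivity) (by positivity)] at h
  exact_mod_cast h

/-- For edge-labelled triangulations of a convex polygon — which, for
points in convex position, are exactly the edge-labelled pointed pseudo-triangulations
with exchanging flips — there exist pairs whose flip distance is `Ω(n log n)`: there is a
constant `c > 0` such that for all sufficiently large `n` some pair of edge-labelled
triangulations of the convex `n`-gon requires at least `c · n · log n` flips. -/
theorem exists_labelled_triangulations_flip_distance_lower_bound :
    ∃ c : ℝ, 0 < c ∧ ∃ N : ℕ, ∀ n : ℕ, N ≤ n → ∀ _ : NeZero n,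
      ∃ T₁ T₂ : LabelledTriangulation n,
        ∀ l : List (LabelledTriangulation n),
          List.Chain Flip T₁ l → (T₁ :: l).getLast (List.cons_ne_nil _ _) = T₂ →
            c * n * Real.log n ≤ l.length := by
  refine ⟨1 / 100, by norm_num, 2 ^ 18, fun n hn _ => ?_⟩
  by_contra! hcon
  have hn₄ : 4 ≤ n := le_trans (by norm_num) hn
  have hfloor := Nat.floor_le (a := 1 / 100 * (n : ℝ) * Real.log n) (by positivity)
  refine (two_pow_lt_factorial hn hfloor).not_ge
    (factorial_le_of_forall_exists_chain hn₄ fun T₁ T₂ => ?_)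
  obtain ⟨l, hl, hlast, hlen⟩ := hcon T₁ T₂
  exact ⟨l, hl, hlast, Nat.le_floor hlen.le⟩
end
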